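/- arXiv:1507.02166 — 6 statements merged into one kernel-verified Lean document; each statement's English description precedes it below -/
import Mathlib

section
/- Let g : ℝ → ℝ satisfy Assumption (G). For ℓ > 0 and each dimension d, set h_d = ℓ² d^{-1/5}, and consider the fMALA proposal kernel q_d for the product target π_d (nondegenerate for all d large enough that h_d · sup|g''| < 12). Define the mean acceptance rate a_d(ℓ) = ∫∫ π_d(x) q_d(x,y) min(1, π_d(y)q_d(y,x)/(π_d(x)q_d(x,y))) dx dy. Then lim_{d→∞} a_d(ℓ) = 2Φ(−K ℓ⁵/2), where Φ is the standard normal cumulative distribution function and K = (E[κ(X)])^{1/2} with X distributed according to the density proportional to e^{g} and κ the explicit polynomial in the derivatives of g given in the context. -/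
open MeasureTheory Filter
open scoped NNReal ENNReal

/-- The standard normal cumulative distribution function. -/
noncomputable def stdNormalCDF (t : ℝ) : ℝ :=
  (Real.sqrt (2 * Real.pi))⁻¹ * ∫ s in Set.Iic t, Real.exp (-s ^ 2 / 2)

/-- Assumption (G): `g ∈ C¹⁰(ℝ)`, `g''` bounded, the derivatives of `g` up to order 10 have
at most polynomial growth, and all moments of `e^g` are finite. -/
def AssumptionG (g : ℝ → ℝ) : Prop :=
  ContDiff ℝ 10 g ∧
  (∃ M : ℝ, ∀ t : ℝ, |iteratedDeriv 2 g t| ≤ M) ∧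
  (∃ C : ℝ, ∃ κ : ℕ, ∀ i : ℕ, 1 ≤ i → i ≤ 10 → ∀ t : ℝ,
      |iteratedDeriv i g t| ≤ C * (1 + |t| ^ κ)) ∧
  (∀ k : ℕ, Integrable (fun t : ℝ => t ^ k * Real.exp (g t)))

/-- The explicit polynomial `κ(x)` in the derivatives of `g` whose mean gives `K²`. -/
noncomputable def kappaFun (g : ℝ → ℝ) (x : ℝ) : ℝ :=
  let g1 := deriv g x
  let g2 := iteratedDeriv 2 g x
  let g3 := iteratedDeriv 3 g x
  let g4 := iteratedDeriv 4 g x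
  let g5 := iteratedDeriv 5 g x
  79 * g5 ^ 2 / 17280 + 11 * g4 ^ 2 * g1 ^ 2 / 1152 + 77 * g3 ^ 2 * g2 ^ 2 / 2592 +
    g3 ^ 2 * g1 ^ 4 / 576 + 49 * g1 ^ 2 * g2 ^ 4 / 20736 + 7 * g4 * g5 * g1 / 576 +
    19 * g3 * g5 * g2 / 864 + g3 * g5 * g1 ^ 2 / 288 + 7 * g5 * g1 * g2 ^ 2 / 1728 +
    g3 * g4 * g1 ^ 3 / 144 + 7 * g4 * g1 ^ 2 * g2 ^ 2 / 864 + 7 * g3 * g1 ^ 3 * g2 ^ 2 / 1728 +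
    5 * g3 ^ 2 * g1 ^ 2 * g2 / 432 + 35 * g3 * g1 * g2 ^ 3 / 2592 +
    29 * g3 * g4 * g1 * g2 / 864

/-- One-dimensional fMALA Gaussian transition density with step `h`. -/
noncomputable def fmalaDensity1 (g : ℝ → ℝ) (h : ℝ) (x y : ℝ) : ℝ :=
  let m : ℝ := x + (h / 2) * deriv g x -
    (h ^ 2 / 24) * (iteratedDeriv 2 g x * deriv g x + iteratedDeriv 3 g x)
  let s : ℝ := Real.sqrt h * (1 + (h / 12) * iteratedDeriv 2 g x)
  (Real.sqrt (2 * Real.pi) * s)⁻¹ * Real.exp (-(y - m) ^ 2 / (2 * s ^ 2))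

/-- The fMALA proposal density on `ℝ^d` for the product target, with step `h`. -/
noncomputable def fmalaDensity (g : ℝ → ℝ) (h : ℝ) (d : ℕ) (x y : Fin d → ℝ) : ℝ :=
  ∏ i, fmalaDensity1 g h (x i) (y i)

/-- The product target density `π_d` on `ℝ^d`. -/
noncomputable def prodTarget (g : ℝ → ℝ) (d : ℕ) (x : Fin d → ℝ) : ℝ :=
  (∏ i, Real.exp (g (x i))) / (∫ t : ℝ, Real.exp (g t)) ^ d

/-- The mean acceptance rate `a_d(ℓ)` of fMALA with step `h_d = ℓ² d^{-1/5}`. -/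
noncomputable def meanAcceptRate (g : ℝ → ℝ) (ℓ : ℝ) (d : ℕ) : ℝ :=
  let h : ℝ := ℓ ^ 2 * (d : ℝ) ^ (-(1 : ℝ) / 5)
  ∫ x : Fin d → ℝ, ∫ y : Fin d → ℝ,
    prodTarget g d x * fmalaDensity g h d x y *
      min 1 (prodTarget g d y * fmalaDensity g h d y x /
        (prodTarget g d x * fmalaDensity g h d x y))

namespace FMALA

open ProbabilityTheory

section PolynomialGrowth

/-- `f ε w = O(ε ^ k)` for `0 < ε ≤ e₀`, with a constant of polynomial growth in `w`. -/
def PolyO (e₀ : ℝ) (k : ℕ) (f : ℝ → ℝ × ℝ → ℝ) : Prop :=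
  ∃ C : ℝ, ∃ N : ℕ, 0 ≤ C ∧ ∀ ε, 0 < ε → ε ≤ e₀ → ∀ w : ℝ × ℝ,
    |f ε w| ≤ C * (1 + |w.1| + |w.2|) ^ N * ε ^ k

namespace PolyO

variable {e₀ : ℝ} {k l : ℕ} {f f' : ℝ → ℝ × ℝ → ℝ}

lemma one_le_weight (w : ℝ × ℝ) : 1 ≤ 1 + |w.1| + |w.2| := by
  have := abs_nonneg w.1
  have := abs_nonneg w.2
  linarith

lemma add (h : PolyO e₀ k f) (h' : PolyO e₀ k f') : PolyO e₀ k (fun ε w => f ε w + f' ε w) := by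
  obtain ⟨C, N, hC, hf⟩ := h
  obtain ⟨C', N', hC', hf'⟩ := h'
  refine ⟨C + C', N + N', by positivity, fun ε h0 h1 w => ?_⟩
  have hw := one_le_weight w
  calc |f ε w + f' ε w| ≤ |f ε w| + |f' ε w| := abs_add_le _ _
    _ ≤ C * (1 + |w.1| + |w.2|) ^ N * ε ^ k + C' * (1 + |w.1| + |w.2|) ^ N' * ε ^ k :=
        add_le_add (hf ε h0 h1 w) (hf' ε h0 h1 w)
    _ ≤ C * (1 + |w.1| + |w.2|) ^ (N + N') * ε ^ k
          + C' * (1 + |w.1| + |w.2|) ^ (N + N') * ε ^ k := by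
        gcongr <;> first | exact hw | omega
    _ = _ := by ring

lemma mul (h : PolyO e₀ k f) (h' : PolyO e₀ l f') :
    PolyO e₀ (k + l) (fun ε w => f ε w * f' ε w) := by
  obtain ⟨C, N, hC, hf⟩ := h
  obtain ⟨C', N', hC', hf'⟩ := h'
  refine ⟨C * C', N + N', by positivity, fun ε h0 h1 w => ?_⟩
  have hw := one_le_weight w
  rw [abs_mul]
  calc |f ε w| * |f' ε w| ≤ (C * (1 + |w.1| + |w.2|) ^ N * ε ^ k) *
        (C' * (1 + |w.1| + |w.2|) ^ N' * ε ^ l) :=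
        mul_le_mul (hf ε h0 h1 w) (hf' ε h0 h1 w) (abs_nonneg _) (by positivity)
    _ = _ := by ring

lemma mul_zero_order (h : PolyO e₀ 0 f) (h' : PolyO e₀ 0 f') :
    PolyO e₀ 0 (fun ε w => f ε w * f' ε w) := h.mul h'

lemma mul_left (h : PolyO e₀ 0 f) (h' : PolyO e₀ k f') :
    PolyO e₀ k (fun ε w => f ε w * f' ε w) := by
  simpa using h.mul h'

lemma mul_right (h : PolyO e₀ k f) (h' : PolyO e₀ 0 f') :
    PolyO e₀ k (fun ε w => f ε w * f' ε w) := h.mul h'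

lemma of_abs_le (h : PolyO e₀ k f)
    (hle : ∀ ε, 0 < ε → ε ≤ e₀ → ∀ w, |f' ε w| ≤ |f ε w|) : PolyO e₀ k f' := by
  obtain ⟨C, N, hC, hf⟩ := h
  exact ⟨C, N, hC, fun ε h0 h1 w => (hle ε h0 h1 w).trans (hf ε h0 h1 w)⟩

lemma congr (h : PolyO e₀ k f) (he : ∀ ε, 0 < ε → ε ≤ e₀ → ∀ w, f' ε w = f ε w) :
    PolyO e₀ k f' :=
  h.of_abs_le fun ε h0 h1 w => (congrArg _ (he ε h0 h1 w)).le

lemma neg (h : PolyO e₀ k f) : PolyO e₀ k (fun ε w => -f ε w) :=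
  h.of_abs_le fun ε _ _ w => (abs_neg (f ε w)).le

lemma mono (he : e₀ ≤ 1) (hkl : k ≤ l) (h : PolyO e₀ l f) : PolyO e₀ k f := by
  obtain ⟨C, N, hC, hf⟩ := h
  refine ⟨C, N, hC, fun ε h0 h1 w => (hf ε h0 h1 w).trans ?_⟩
  have hw := one_le_weight w
  gcongr ?_ * ?_
  exact pow_le_pow_of_le_one h0.le (h1.trans he) hkl

lemma const (c : ℝ) : PolyO e₀ 0 (fun _ _ => c) :=
  ⟨|c|, 0, abs_nonneg c, fun _ _ _ _ => by simp⟩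

lemma eps : PolyO e₀ 1 (fun ε _ => ε) :=
  ⟨1, 0, zero_le_one, fun ε h0 _ _ => by simp [abs_of_pos h0]⟩

lemma eps_zero (he : e₀ ≤ 1) : PolyO e₀ 0 (fun ε _ => ε) := eps.mono he zero_le_one

lemma eps_pow (k : ℕ) : PolyO e₀ k (fun ε _ => ε ^ k) :=
  ⟨1, 0, zero_le_one, fun ε h0 _ _ => by simp [abs_of_pos h0]⟩

lemma fst : PolyO e₀ 0 (fun _ w => w.1) :=
  ⟨1, 1, zero_le_one, fun _ _ _ w => by
    have := abs_nonneg w.2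
    simp only [one_mul, pow_one, pow_zero, mul_one]; linarith⟩

lemma snd : PolyO e₀ 0 (fun _ w => w.2) :=
  ⟨1, 1, zero_le_one, fun _ _ _ w => by
    have := abs_nonneg w.1
    simp only [one_mul, pow_one, pow_zero, mul_one]; linarith⟩

lemma pow (h : PolyO e₀ k f) (n : ℕ) : PolyO e₀ (k * n) (fun ε w => f ε w ^ n) := by
  induction n with
  | zero => simpa using const 1
  | succ n ih => simpa only [pow_succ, Nat.mul_succ] using ih.mul h

lemma abs (h : PolyO e₀ k f) : PolyO e₀ k (fun ε w => |f ε w|) :=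
  h.of_abs_le fun ε _ _ w => (abs_abs (f ε w)).le

lemma comp_of_growth (h : PolyO e₀ 0 f) {φ : ℝ → ℝ} {C : ℝ} {κ : ℕ}
    (hφ : ∀ t, |φ t| ≤ C * (1 + |t| ^ κ)) : PolyO e₀ 0 (fun ε w => φ (f ε w)) := by
  have hκ : PolyO e₀ 0 (fun ε w => |f ε w| ^ κ) := by simpa using h.abs.pow κ
  exact ((const C).mul ((const 1).add hκ)).of_abs_le
    fun ε _ _ w => (hφ _).trans (le_abs_self _)

end PolyO

/-- The function `f` of `ε` has the expansion `a₀ + a₁ ε + ⋯ + a₅ ε⁵ + O(ε⁶)`, with coefficients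
and remainder of polynomial growth. -/
structure HasExp (e₀ : ℝ) (f : ℝ → ℝ × ℝ → ℝ) (a₀ a₁ a₂ a₃ a₄ a₅ : ℝ × ℝ → ℝ) : Prop where
  c₀ : PolyO e₀ 0 (fun _ => a₀)
  c₁ : PolyO e₀ 0 (fun _ => a₁)
  c₂ : PolyO e₀ 0 (fun _ => a₂)
  c₃ : PolyO e₀ 0 (fun _ => a₃)
  c₄ : PolyO e₀ 0 (fun _ => a₄)
  c₅ : PolyO e₀ 0 (fun _ => a₅)
  rem : PolyO e₀ 6 (fun ε w => f ε w - (a₀ w + a₁ w * ε + a₂ w * ε ^ 2 + a₃ w * ε ^ 3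
    + a₄ w * ε ^ 4 + a₅ w * ε ^ 5))

namespace HasExp

variable {e₀ : ℝ} {f f' : ℝ → ℝ × ℝ → ℝ} {a₀ a₁ a₂ a₃ a₄ a₅ b₀ b₁ b₂ b₃ b₄ b₅ : ℝ × ℝ → ℝ}

lemma add (h : HasExp e₀ f a₀ a₁ a₂ a₃ a₄ a₅) (h' : HasExp e₀ f' b₀ b₁ b₂ b₃ b₄ b₅) :
    HasExp e₀ (fun ε w => f ε w + f' ε w) (fun w => a₀ w + b₀ w) (fun w => a₁ w + b₁ w)
      (fun w => a₂ w + b₂ w) (fun w => a₃ w + b₃ w) (fun w => a₄ w + b₄ w)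
      (fun w => a₅ w + b₅ w) where
  c₀ := h.c₀.add h'.c₀
  c₁ := h.c₁.add h'.c₁
  c₂ := h.c₂.add h'.c₂
  c₃ := h.c₃.add h'.c₃
  c₄ := h.c₄.add h'.c₄
  c₅ := h.c₅.add h'.c₅
  rem := (h.rem.add h'.rem).congr fun ε _ _ w => by ring

lemma poly_bound (he : e₀ ≤ 1) (h : HasExp e₀ f a₀ a₁ a₂ a₃ a₄ a₅) :
    PolyO e₀ 0 (fun ε w => a₀ w + a₁ w * ε + a₂ w * ε ^ 2 + a₃ w * ε ^ 3
    + a₄ w * ε ^ 4 + a₅ w * ε ^ 5) := by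
  have e (k : ℕ) := (PolyO.eps_pow (e₀ := e₀) k).mono he (Nat.zero_le k)
  exact ((((h.c₀.add (h.c₁.mul_zero_order (PolyO.eps_zero he))).add
    (h.c₂.mul_zero_order (e 2))).add (h.c₃.mul_zero_order (e 3))).add
    (h.c₄.mul_zero_order (e 4))).add (h.c₅.mul_zero_order (e 5))

lemma bound (he : e₀ ≤ 1) (h : HasExp e₀ f a₀ a₁ a₂ a₃ a₄ a₅) : PolyO e₀ 0 f :=
  ((h.rem.mono he (Nat.zero_le 6)).add (h.poly_bound he)).congr fun ε _ _ w => by ring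

lemma mul (he : e₀ ≤ 1) (h : HasExp e₀ f a₀ a₁ a₂ a₃ a₄ a₅)
    (h' : HasExp e₀ f' b₀ b₁ b₂ b₃ b₄ b₅) :
    HasExp e₀ (fun ε w => f ε w * f' ε w) (fun w => a₀ w * b₀ w)
      (fun w => a₀ w * b₁ w + a₁ w * b₀ w)
      (fun w => a₀ w * b₂ w + a₁ w * b₁ w + a₂ w * b₀ w)
      (fun w => a₀ w * b₃ w + a₁ w * b₂ w + a₂ w * b₁ w + a₃ w * b₀ w)
      (fun w => a₀ w * b₄ w + a₁ w * b₃ w + a₂ w * b₂ w + a₃ w * b₁ w + a₄ w * b₀ w)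
      (fun w => a₀ w * b₅ w + a₁ w * b₄ w + a₂ w * b₃ w + a₃ w * b₂ w + a₄ w * b₁ w
        + a₅ w * b₀ w) := by
  obtain ⟨p₀, p₁, p₂, p₃, p₄, p₅, -⟩ := id h
  obtain ⟨q₀, q₁, q₂, q₃, q₄, q₅, -⟩ := id h'
  have e := PolyO.eps_zero he
  have hQ : PolyO e₀ 0 (fun ε w => (a₁ w * b₅ w + a₂ w * b₄ w + a₃ w * b₃ w + a₄ w * b₂ w
      + a₅ w * b₁ w) + ε * ((a₂ w * b₅ w + a₃ w * b₄ w + a₄ w * b₃ w + a₅ w * b₂ w)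
      + ε * ((a₃ w * b₅ w + a₄ w * b₄ w + a₅ w * b₃ w)
      + ε * ((a₄ w * b₅ w + a₅ w * b₄ w) + ε * (a₅ w * b₅ w))))) := by
    repeat' first | assumption | apply PolyO.add | apply PolyO.mul_zero_order
  refine ⟨?_, ?_, ?_, ?_, ?_, ?_, ?rem⟩
  case rem => exact (((h.rem.mul_right (h'.bound he)).add ((h.poly_bound he).mul_left h'.rem)).add
    ((PolyO.eps_pow 6).mul_right hQ)).congr fun ε _ _ w => by ring
  all_goals repeat' first | assumption | apply PolyO.add | apply PolyO.mul_zero_order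

lemma congr (h : HasExp e₀ f a₀ a₁ a₂ a₃ a₄ a₅)
    (h₀ : ∀ w, a₀ w = b₀ w) (h₁ : ∀ w, a₁ w = b₁ w) (h₂ : ∀ w, a₂ w = b₂ w)
    (h₃ : ∀ w, a₃ w = b₃ w) (h₄ : ∀ w, a₄ w = b₄ w) (h₅ : ∀ w, a₅ w = b₅ w) :
    HasExp e₀ f b₀ b₁ b₂ b₃ b₄ b₅ := by
  obtain rfl := funext h₀
  obtain rfl := funext h₁
  obtain rfl := funext h₂
  obtain rfl := funext h₃
  obtain rfl := funext h₄
  obtain rfl := funext h₅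
  exact h

lemma of_sub (h : HasExp e₀ f a₀ a₁ a₂ a₃ a₄ a₅) (hd : PolyO e₀ 6 (fun ε w => f' ε w - f ε w)) :
    HasExp e₀ f' a₀ a₁ a₂ a₃ a₄ a₅ :=
  { h with rem := (hd.add h.rem).congr fun ε _ _ w => by ring }

lemma congr_fun (h : HasExp e₀ f a₀ a₁ a₂ a₃ a₄ a₅)
    (hd : ∀ ε, 0 < ε → ε ≤ e₀ → ∀ w, f' ε w = f ε w) :
    HasExp e₀ f' a₀ a₁ a₂ a₃ a₄ a₅ :=
  { h with rem := h.rem.congr fun ε h0 h1 w => by rw [hd ε h0 h1 w] }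

lemma poly (h₀ : PolyO e₀ 0 (fun _ => a₀)) (h₁ : PolyO e₀ 0 (fun _ => a₁))
    (h₂ : PolyO e₀ 0 (fun _ => a₂)) (h₃ : PolyO e₀ 0 (fun _ => a₃))
    (h₄ : PolyO e₀ 0 (fun _ => a₄)) (h₅ : PolyO e₀ 0 (fun _ => a₅)) :
    HasExp e₀ (fun ε w => a₀ w + a₁ w * ε + a₂ w * ε ^ 2 + a₃ w * ε ^ 3
    + a₄ w * ε ^ 4 + a₅ w * ε ^ 5) a₀ a₁ a₂ a₃ a₄ a₅ :=
  ⟨h₀, h₁, h₂, h₃, h₄, h₅, ⟨0, 0, le_rfl, fun ε h0 _ w => by simp⟩⟩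

lemma coeff {a : ℝ × ℝ → ℝ} (ha : PolyO e₀ 0 (fun _ => a)) :
    HasExp e₀ (fun _ w => a w) a (fun _ => 0) (fun _ => 0) (fun _ => 0) (fun _ => 0)
      (fun _ => 0) :=
  (poly ha (.const 0) (.const 0) (.const 0) (.const 0) (.const 0)).congr_fun
    fun ε _ _ w => by ring

lemma coeff_mul {a : ℝ × ℝ → ℝ} (ha : PolyO e₀ 0 (fun _ => a))
    (h : HasExp e₀ f a₀ a₁ a₂ a₃ a₄ a₅) :
    HasExp e₀ (fun ε w => a w * f ε w) (fun w => a w * a₀ w) (fun w => a w * a₁ w)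
      (fun w => a w * a₂ w) (fun w => a w * a₃ w) (fun w => a w * a₄ w)
      (fun w => a w * a₅ w) :=
  ⟨ha.mul_left h.c₀, ha.mul_left h.c₁, ha.mul_left h.c₂, ha.mul_left h.c₃, ha.mul_left h.c₄,
    ha.mul_left h.c₅, (ha.mul_left h.rem).congr fun ε _ _ w => by ring⟩

lemma eps_mul (he : e₀ ≤ 1) (h : HasExp e₀ f a₀ a₁ a₂ a₃ a₄ a₅) :
    HasExp e₀ (fun ε w => ε * f ε w) (fun _ => 0) a₀ a₁ a₂ a₃ a₄ :=
  ⟨.const 0, h.c₀, h.c₁, h.c₂, h.c₃, h.c₄,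
    ((h.c₅.mul_left (PolyO.eps_pow 6)).add ((PolyO.eps_zero he).mul_left h.rem)).congr
      fun ε _ _ w => by ring⟩

end HasExp

end PolynomialGrowth

section Taylor

lemma exists_taylor_remainder {φ : ℝ → ℝ} (hφ : ContDiff ℝ 6 φ) (x δ : ℝ) :
    ∃ ξ : ℝ, |ξ| ≤ |x| + |δ| ∧ φ (x + δ) - φ x = iteratedDeriv 1 φ x * δ
      + iteratedDeriv 2 φ x / 2 * δ ^ 2 + iteratedDeriv 3 φ x / 6 * δ ^ 3
      + iteratedDeriv 4 φ x / 24 * δ ^ 4 + iteratedDeriv 5 φ x / 120 * δ ^ 5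
      + iteratedDeriv 6 φ ξ / 720 * δ ^ 6 := by
  rcases eq_or_ne δ 0 with rfl | hδ
  · exact ⟨x, by simp, by simp⟩
  have hx : x ≠ x + δ := by simpa using hδ
  obtain ⟨ξ, hξ, h⟩ := taylor_mean_remainder_lagrange_iteratedDeriv (n := 5) hx
    (hφ.of_le (by norm_num)).contDiffOn
  have hd (j : ℕ) (hj : j ≤ 6) :
      iteratedDerivWithin j φ (Set.uIcc x (x + δ)) x = iteratedDeriv j φ x :=
    iteratedDerivWithin_eq_iteratedDeriv (uniqueDiffOn_uIcc hx)
      (hφ.of_le (by exact_mod_cast hj)).contDiffAt Set.left_mem_uIcc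
  refine ⟨ξ, ?_, ?_⟩
  · have h1 : |ξ - x| ≤ |δ| := by
      simpa using Set.abs_sub_left_of_mem_uIcc (Set.Ioo_subset_Icc_self hξ)
    calc |ξ| = |x + (ξ - x)| := by ring_nf
      _ ≤ |x| + |δ| := (abs_add_le _ _).trans (by gcongr)
  · rw [taylor_within_apply] at h
    simp only [Finset.sum_range_succ, Finset.sum_range_zero, hd 0 (by norm_num),
      hd 1 (by norm_num), hd 2 (by norm_num), hd 3 (by norm_num), hd 4 (by norm_num),
      hd 5 (by norm_num), Nat.factorial, smul_eq_mul, iteratedDeriv_zero] at h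
    norm_num at h ⊢
    linear_combination h

variable {e₀ : ℝ}

lemma HasExp.order_one (he : e₀ ≤ 1) {δ : ℝ → ℝ × ℝ → ℝ} {a₁ a₂ a₃ a₄ a₅ : ℝ × ℝ → ℝ}
    (hδ : HasExp e₀ δ (fun _ => 0) a₁ a₂ a₃ a₄ a₅) : PolyO e₀ 1 δ := by
  have hp := (HasExp.poly hδ.c₁ hδ.c₂ hδ.c₃ hδ.c₄ hδ.c₅ (.const 0)).bound he
  exact ((PolyO.eps.mul_right hp).add (hδ.rem.mono he (by norm_num))).congr
    fun ε _ _ w => by ring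

/-- Expansion of the increment of a function along an increment with a given expansion. -/
lemma HasExp.comp_increment (he : e₀ ≤ 1) {φ : ℝ → ℝ} (hφ : ContDiff ℝ 6 φ) {C : ℝ} {κ : ℕ}
    (hgr : ∀ j, 1 ≤ j → j ≤ 6 → ∀ t, |iteratedDeriv j φ t| ≤ C * (1 + |t| ^ κ))
    {δ : ℝ → ℝ × ℝ → ℝ} {a₁ a₂ a₃ a₄ a₅ : ℝ × ℝ → ℝ}
    (hδ : HasExp e₀ δ (fun _ => 0) a₁ a₂ a₃ a₄ a₅) :
    HasExp e₀ (fun ε w => φ (w.1 + δ ε w) - φ w.1) (fun _ => 0)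
      (fun w => iteratedDeriv 1 φ w.1 * a₁ w)
      (fun w => iteratedDeriv 1 φ w.1 * a₂ w + iteratedDeriv 2 φ w.1 * a₁ w ^ 2 / 2)
      (fun w => iteratedDeriv 1 φ w.1 * a₃ w + iteratedDeriv 2 φ w.1 * (a₁ w * a₂ w)
        + iteratedDeriv 3 φ w.1 * a₁ w ^ 3 / 6)
      (fun w => iteratedDeriv 1 φ w.1 * a₄ w
        + iteratedDeriv 2 φ w.1 * (a₁ w * a₃ w + a₂ w ^ 2 / 2)
        + iteratedDeriv 3 φ w.1 * (a₁ w ^ 2 * a₂ w) / 2 + iteratedDeriv 4 φ w.1 * a₁ w ^ 4 / 24)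
      (fun w => iteratedDeriv 1 φ w.1 * a₅ w
        + iteratedDeriv 2 φ w.1 * (a₁ w * a₄ w + a₂ w * a₃ w)
        + iteratedDeriv 3 φ w.1 * (a₁ w ^ 2 * a₃ w + a₁ w * a₂ w ^ 2) / 2
        + iteratedDeriv 4 φ w.1 * (a₁ w ^ 3 * a₂ w) / 6
        + iteratedDeriv 5 φ w.1 * a₁ w ^ 5 / 120) := by
  have hd (j : ℕ) (h1 : 1 ≤ j) (h6 : j ≤ 6) :
      PolyO e₀ 0 (fun _ w => iteratedDeriv j φ w.1) := PolyO.fst.comp_of_growth (hgr j h1 h6)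
  have hd' (j : ℕ) (h1 : 1 ≤ j) (h6 : j ≤ 6) (c : ℝ) :
      PolyO e₀ 0 (fun _ w => iteratedDeriv j φ w.1 / c) :=
    ((hd j h1 h6).mul_zero_order (.const c⁻¹)).congr fun _ _ _ _ => div_eq_mul_inv _ _
  have h2 := hδ.mul he hδ
  have h3 := h2.mul he hδ
  have h4 := h3.mul he hδ
  have h5 := h4.mul he hδ
  have hsum := ((((HasExp.coeff_mul (hd 1 (by norm_num) (by norm_num)) hδ).add
    (HasExp.coeff_mul (hd' 2 (by norm_num) (by norm_num) 2) h2)).add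
    (HasExp.coeff_mul (hd' 3 (by norm_num) (by norm_num) 6) h3)).add
    (HasExp.coeff_mul (hd' 4 (by norm_num) (by norm_num) 24) h4)).add
    (HasExp.coeff_mul (hd' 5 (by norm_num) (by norm_num) 120) h5)
  have hδ1 := hδ.order_one he
  have hκ : PolyO e₀ 0 (fun ε w => |C| * (1 + (|w.1| + |δ ε w|) ^ κ)) := by
    have : PolyO e₀ 0 (fun ε w => (|w.1| + |δ ε w|) ^ κ) := by
      simpa using (PolyO.fst.abs.add (hδ1.mono he zero_le_one).abs).pow κ
    exact (PolyO.const |C|).mul_zero_order ((PolyO.const 1).add this)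
  have hrem : PolyO e₀ 6 (fun ε w => |C| * (1 + (|w.1| + |δ ε w|) ^ κ) * δ ε w ^ 6) :=
    hκ.mul_left (hδ1.pow 6)
  refine HasExp.congr (HasExp.of_sub hsum (hrem.of_abs_le fun ε h0 h1 w => ?_)) ?_ ?_ ?_ ?_ ?_ ?_
  · obtain ⟨ξ, hξ, h⟩ := exists_taylor_remainder hφ w.1 (δ ε w)
    rw [h, abs_mul (|C| * _), abs_of_nonneg (by positivity :
      0 ≤ |C| * (1 + (|w.1| + |δ ε w|) ^ κ))]
    have hb : |iteratedDeriv 6 φ ξ| ≤ |C| * (1 + (|w.1| + |δ ε w|) ^ κ) := by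
      refine (hgr 6 (by norm_num) le_rfl ξ).trans ?_
      gcongr
      exact le_abs_self C
    calc _ = |iteratedDeriv 6 φ ξ| / 720 * |δ ε w ^ 6| := by
          rw [← abs_of_pos (by norm_num : (0 : ℝ) < 720), ← abs_div, ← abs_mul,
            abs_of_pos (by norm_num : (0 : ℝ) < 720)]
          congr 1
          ring
      _ ≤ |iteratedDeriv 6 φ ξ| * |δ ε w ^ 6| := by
          gcongr
          exact div_le_self (abs_nonneg _) (by norm_num)
      _ ≤ _ := by gcongr
  all_goals intro w; ring

lemma abs_log_one_add_sub_le {u : ℝ} (hu : |u| ≤ 1 / 2) :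
    |Real.log (1 + u) - (u - u ^ 2 / 2)| ≤ 2 * |u| ^ 3 := by
  have h := Real.abs_log_sub_add_sum_range_le (x := -u) (by rw [abs_neg]; linarith) 2
  rw [abs_neg] at h
  have h2 : |u| ^ 3 / (1 - |u|) ≤ 2 * |u| ^ 3 := by
    rw [div_le_iff₀ (by linarith)]
    nlinarith [pow_nonneg (abs_nonneg u) 3]
  refine le_trans (le_of_eq ?_) (h.trans h2)
  congr 1
  simp [Finset.sum_range_succ]
  ring

lemma abs_inv_one_add_sq_sub_le {u : ℝ} (hu : |u| ≤ 1 / 2) :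
    |((1 + u) ^ 2)⁻¹ - (1 - 2 * u + 3 * u ^ 2)| ≤ 24 * |u| ^ 3 := by
  obtain ⟨h1, h2⟩ := abs_le.1 hu
  have hpos : 1 / 4 ≤ (1 + u) ^ 2 := by nlinarith
  have heq : ((1 + u) ^ 2)⁻¹ - (1 - 2 * u + 3 * u ^ 2)
      = (-(4 + 3 * u)) * u ^ 3 * ((1 + u) ^ 2)⁻¹ := by
    have : 1 + u ≠ 0 := (by linarith : 0 < 1 + u).ne'
    field_simp
    ring
  rw [heq, abs_mul, abs_mul, abs_pow, abs_inv, abs_of_nonneg (sq_nonneg (1 + u))]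
  have h3 : |-(4 + 3 * u)| ≤ 6 := by rw [abs_le]; constructor <;> linarith
  have h4 : ((1 + u) ^ 2)⁻¹ ≤ 4 := by
    rw [inv_le_comm₀ (by positivity) (by norm_num)]; linarith
  calc _ ≤ 6 * |u| ^ 3 * 4 := by gcongr
    _ = _ := by ring

end Taylor

section Move

variable {g : ℝ → ℝ} {e₀ : ℝ}

lemma iteratedDeriv_iteratedDeriv_eq (g : ℝ → ℝ) (j k : ℕ) :
    iteratedDeriv j (iteratedDeriv k g) = iteratedDeriv (k + j) g := by
  simp only [iteratedDeriv_eq_iterate, add_comm k j, Function.iterate_add_apply]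

/-- The `k`-th derivative of `g` at the first coordinate of `w = (x, z)`. -/
noncomputable def dg (g : ℝ → ℝ) (k : ℕ) (w : ℝ × ℝ) : ℝ := iteratedDeriv k g w.1

/-- The increment of an fMALA move from `x` with step `ε²` and Gaussian noise `z`,
where `w = (x, z)`. -/
noncomputable def moveIncrement (g : ℝ → ℝ) (ε : ℝ) (w : ℝ × ℝ) : ℝ :=
  w.2 * ε + dg g 1 w / 2 * ε ^ 2 + dg g 2 w * w.2 / 12 * ε ^ 3
    - (dg g 2 w * dg g 1 w + dg g 3 w) / 24 * ε ^ 4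

/-- The end point of an fMALA move from `x` with step `ε²` and Gaussian noise `z`. -/
noncomputable def moveTarget (g : ℝ → ℝ) (ε : ℝ) (w : ℝ × ℝ) : ℝ :=
  w.1 + moveIncrement g ε w

/-- The rescaled displacement `(m(y) - x) / ε` of the reverse move. -/
noncomputable def reverseNoise (g : ℝ → ℝ) (ε : ℝ) (w : ℝ × ℝ) : ℝ :=
  w.2 + ε * (dg g 1 w / 2 + iteratedDeriv 1 g (moveTarget g ε w) / 2)
    + ε ^ 2 * (dg g 2 w * w.2 / 12) - ε ^ 3 * ((dg g 2 w * dg g 1 w + dg g 3 w)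
      + (iteratedDeriv 2 g (moveTarget g ε w) * iteratedDeriv 1 g (moveTarget g ε w)
        + iteratedDeriv 3 g (moveTarget g ε w))) / 24

/-- The log acceptance ratio of a one-dimensional fMALA move. -/
noncomputable def logRatio (g : ℝ → ℝ) (ε : ℝ) (w : ℝ × ℝ) : ℝ :=
  (g (moveTarget g ε w) - g w.1) + Real.log (1 + ε ^ 2 * (dg g 2 w / 12))
    - Real.log (1 + ε ^ 2 * (iteratedDeriv 2 g (moveTarget g ε w) / 12)) + w.2 ^ 2 / 2
    - reverseNoise g ε w ^ 2 / 2 *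
      ((1 + ε ^ 2 * (iteratedDeriv 2 g (moveTarget g ε w) / 12)) ^ 2)⁻¹

/-- The coefficient of `ε⁵` in the expansion of `logRatio`. -/
noncomputable def leadCoeff (g : ℝ → ℝ) (w : ℝ × ℝ) : ℝ :=
  w.2 * (dg g 2 w * dg g 3 w / 72 + dg g 1 w * dg g 4 w / 48 + 7 * dg g 1 w * dg g 2 w ^ 2 / 144
      + dg g 1 w ^ 2 * dg g 3 w / 24)
    + w.2 ^ 3 * (dg g 5 w / 144 + dg g 2 w * dg g 3 w / 24 + dg g 1 w * dg g 4 w / 48)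
    + w.2 ^ 5 * (dg g 5 w / 720)

lemma polyO_dg (hg : AssumptionG g) {k : ℕ} (h1 : 1 ≤ k) (h10 : k ≤ 10) :
    PolyO e₀ 0 (fun _ => dg g k) := by
  obtain ⟨-, -, ⟨C, κ, hC⟩, -⟩ := hg
  exact PolyO.fst.comp_of_growth (hC k h1 h10)

lemma hasExp_moveIncrement (hg : AssumptionG g) :
    HasExp e₀ (moveIncrement g) (fun _ => 0) (fun w => w.2) (fun w => dg g 1 w / 2)
      (fun w => dg g 2 w * w.2 / 12) (fun w => -(dg g 2 w * dg g 1 w + dg g 3 w) / 24)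
      (fun _ => 0) := by
  have h1 := polyO_dg (e₀ := e₀) hg (k := 1) (by norm_num) (by norm_num)
  have h2 := polyO_dg (e₀ := e₀) hg (k := 2) (by norm_num) (by norm_num)
  have h3 := polyO_dg (e₀ := e₀) hg (k := 3) (by norm_num) (by norm_num)
  refine (HasExp.poly (.const 0) .snd ?_ ?_ ?_ (.const 0)).congr_fun
    fun ε _ _ w => by unfold moveIncrement; ring
  · exact (h1.mul_zero_order (.const 2⁻¹)).congr fun _ _ _ _ => div_eq_mul_inv _ _
  · exact ((h2.mul_zero_order .snd).mul_zero_order (.const 12⁻¹)).congr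
      fun _ _ _ _ => div_eq_mul_inv _ _
  · exact (((h2.mul_zero_order h1).add h3).neg.mul_zero_order (.const 24⁻¹)).congr
      fun _ _ _ _ => div_eq_mul_inv _ _

/-- Expansion of the increment of a derivative of `g` along an fMALA move. -/
lemma hasExp_sub_moveTarget (he : e₀ ≤ 1) (hg : AssumptionG g) {k : ℕ} (hk : k ≤ 4) :
    HasExp e₀ (fun ε w => iteratedDeriv k g (moveTarget g ε w) - dg g k w) (fun _ => 0)
      (fun w => dg g (k + 1) w * w.2)
      (fun w => dg g (k + 1) w * dg g 1 w / 2 + dg g (k + 2) w * w.2 ^ 2 / 2)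
      (fun w => dg g (k + 1) w * dg g 2 w * w.2 / 12 + dg g (k + 2) w * w.2 * dg g 1 w / 2
        + dg g (k + 3) w * w.2 ^ 3 / 6)
      (fun w => -dg g (k + 1) w * (dg g 2 w * dg g 1 w + dg g 3 w) / 24
        + dg g (k + 2) w * (dg g 2 w * w.2 ^ 2 / 12 + dg g 1 w ^ 2 / 8)
        + dg g (k + 3) w * dg g 1 w * w.2 ^ 2 / 4 + dg g (k + 4) w * w.2 ^ 4 / 24)
      (fun w => dg g (k + 2) w * w.2 * (-(dg g 2 w * dg g 1 w + dg g 3 w) / 24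
          + dg g 1 w * dg g 2 w / 24)
        + dg g (k + 3) w * (dg g 2 w * w.2 ^ 3 / 24 + dg g 1 w ^ 2 * w.2 / 8)
        + dg g (k + 4) w * dg g 1 w * w.2 ^ 3 / 12 + dg g (k + 5) w * w.2 ^ 5 / 120) := by
  have hδ := hasExp_moveIncrement (e₀ := e₀) hg
  obtain ⟨hc, -, ⟨C, κ, hC⟩, -⟩ := hg
  have hφ : ContDiff ℝ 6 (iteratedDeriv k g) := by
    have hc' : ContDiff ℝ ((6 + k : ℕ) : WithTop ℕ∞) g :=
      hc.of_le (by exact_mod_cast (by omega : 6 + k ≤ 10))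
    rw [iteratedDeriv_eq_iterate]
    exact ContDiff.iterate_deriv' 6 k (by exact_mod_cast hc')
  have h := HasExp.comp_increment he hφ (C := C) (κ := κ)
    (fun j h1 h6 t => by
      rw [iteratedDeriv_iteratedDeriv_eq]
      exact hC _ (by omega) (by omega) t) hδ
  simp only [iteratedDeriv_iteratedDeriv_eq] at h
  refine h.congr ?_ ?_ ?_ ?_ ?_ ?_ <;> intro w <;> simp only [dg] <;> ring

lemma hasExp_moveTarget (he : e₀ ≤ 1) (hg : AssumptionG g) {k : ℕ} (h1 : 1 ≤ k) (hk : k ≤ 4) :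
    HasExp e₀ (fun ε w => iteratedDeriv k g (moveTarget g ε w)) (dg g k)
      (fun w => dg g (k + 1) w * w.2)
      (fun w => dg g (k + 1) w * dg g 1 w / 2 + dg g (k + 2) w * w.2 ^ 2 / 2)
      (fun w => dg g (k + 1) w * dg g 2 w * w.2 / 12 + dg g (k + 2) w * w.2 * dg g 1 w / 2
        + dg g (k + 3) w * w.2 ^ 3 / 6)
      (fun w => -dg g (k + 1) w * (dg g 2 w * dg g 1 w + dg g 3 w) / 24
        + dg g (k + 2) w * (dg g 2 w * w.2 ^ 2 / 12 + dg g 1 w ^ 2 / 8)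
        + dg g (k + 3) w * dg g 1 w * w.2 ^ 2 / 4 + dg g (k + 4) w * w.2 ^ 4 / 24)
      (fun w => dg g (k + 2) w * w.2 * (-(dg g 2 w * dg g 1 w + dg g 3 w) / 24
          + dg g 1 w * dg g 2 w / 24)
        + dg g (k + 3) w * (dg g 2 w * w.2 ^ 3 / 24 + dg g 1 w ^ 2 * w.2 / 8)
        + dg g (k + 4) w * dg g 1 w * w.2 ^ 3 / 12 + dg g (k + 5) w * w.2 ^ 5 / 120) :=
  (((HasExp.coeff (polyO_dg hg h1 (by omega))).add (hasExp_sub_moveTarget he hg hk)).congr_fun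
    fun ε _ _ w => by ring).congr (fun w => by ring) (fun w => by ring) (fun w => by ring)
    (fun w => by ring) (fun w => by ring) (fun w => by ring)

lemma hasExp_reverseNoise (he : e₀ ≤ 1) (hg : AssumptionG g) :
    HasExp e₀ (reverseNoise g) (fun w => w.2) (dg g 1) (fun w => 7 * w.2 * dg g 2 w / 12)
      (fun w => -dg g 3 w / 12 + dg g 1 w * dg g 2 w / 6 + w.2 ^ 2 * dg g 3 w / 4)
      (fun w => -w.2 * dg g 4 w / 24 + 5 * w.2 * dg g 1 w * dg g 3 w / 24
        + w.2 ^ 3 * dg g 4 w / 12)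
      (fun w => -dg g 2 w * dg g 3 w / 48 - dg g 1 w * dg g 4 w / 48
        - dg g 1 w * dg g 2 w ^ 2 / 24 + dg g 1 w ^ 2 * dg g 3 w / 24 - w.2 ^ 2 * dg g 5 w / 48
        - w.2 ^ 2 * dg g 2 w * dg g 3 w / 48 + 5 * w.2 ^ 2 * dg g 1 w * dg g 4 w / 48
        + w.2 ^ 4 * dg g 5 w / 48) := by
  have p (k : ℕ) (h1 : 1 ≤ k) (h2 : k ≤ 10) :=
    HasExp.coeff (polyO_dg (e₀ := e₀) hg h1 h2)
  have p1 := p 1 (by norm_num) (by norm_num)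
  have p2 := p 2 (by norm_num) (by norm_num)
  have p3 := p 3 (by norm_num) (by norm_num)
  have H1 := hasExp_moveTarget he hg (k := 1) (by norm_num) (by norm_num)
  have H2 := hasExp_moveTarget he hg (k := 2) (by norm_num) (by norm_num)
  have H3 := hasExp_moveTarget he hg (k := 3) (by norm_num) (by norm_num)
  have hz := HasExp.coeff (PolyO.snd (e₀ := e₀))
  have hdrift := ((p2.mul he p1).add p3).add ((H2.mul he H1).add H3)
  refine ((((hz.add (HasExp.eps_mul he (HasExp.coeff_mul (.const (1 / 2)) (p1.add H1)))).add
    (HasExp.eps_mul he (HasExp.eps_mul he (HasExp.coeff_mul (.const (1 / 12))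
      (p2.mul he hz))))).add (HasExp.eps_mul he (HasExp.eps_mul he (HasExp.eps_mul he
      (HasExp.coeff_mul (.const (-1 / 24)) hdrift))))).congr_fun
        fun ε _ _ w => ?_).congr ?_ ?_ ?_ ?_ ?_ ?_
  · unfold reverseNoise; ring
  all_goals intro w; norm_num; try ring

end Move

section LogRatio

variable {g : ℝ → ℝ} {e₀ : ℝ}

lemma abs_rescaled_le_half {M ε b : ℝ} (h0 : 0 < ε) (h1 : ε ≤ e₀) (hM : e₀ ^ 2 * M ≤ 6)
    (hb : |b| ≤ M) : |ε ^ 2 * (b / 12)| ≤ 1 / 2 := by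
  have hM0 : 0 ≤ M := (abs_nonneg b).trans hb
  rw [abs_mul, abs_div, abs_of_pos (by positivity : 0 < ε ^ 2),
    abs_of_pos (by norm_num : (0 : ℝ) < 12)]
  have : ε ^ 2 * |b| ≤ e₀ ^ 2 * M := by gcongr
  linarith

lemma HasExp.comp_of_abs_sub_le {f u : ℝ → ℝ × ℝ → ℝ} {a₀ a₁ a₂ a₃ a₄ a₅ : ℝ × ℝ → ℝ}
    (h : HasExp e₀ f a₀ a₁ a₂ a₃ a₄ a₅) (hu : PolyO e₀ 2 u) {φ : ℝ → ℝ} {c : ℝ}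
    (hle : ∀ ε, 0 < ε → ε ≤ e₀ → ∀ w, |φ (u ε w) - f ε w| ≤ c * |u ε w| ^ 3) :
    HasExp e₀ (fun ε w => φ (u ε w)) a₀ a₁ a₂ a₃ a₄ a₅ :=
  h.of_sub (((PolyO.const c).mul_left (hu.abs.pow 3)).of_abs_le
    fun ε h0 h1 w => (hle ε h0 h1 w).trans (le_abs_self _))

/-- The log acceptance ratio is `leadCoeff g * ε ^ 5 + O(ε ^ 6)`. -/
lemma hasExp_logRatio (he : e₀ ≤ 1) (hg : AssumptionG g) {M : ℝ}
    (hM : ∀ t, |iteratedDeriv 2 g t| ≤ M) (heM : e₀ ^ 2 * M ≤ 6) :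
    HasExp e₀ (logRatio g) (fun _ => 0) (fun _ => 0) (fun _ => 0) (fun _ => 0) (fun _ => 0)
      (leadCoeff g) := by
  have p2 := HasExp.coeff (polyO_dg (e₀ := e₀) hg (k := 2) (by norm_num) (by norm_num))
  have hz := HasExp.coeff (PolyO.snd (e₀ := e₀))
  have H0 := hasExp_sub_moveTarget he hg (k := 0) (by norm_num)
  have H2 := hasExp_moveTarget he hg (k := 2) (by norm_num) (by norm_num)
  have hu := (HasExp.eps_mul he (HasExp.eps_mul he (HasExp.coeff_mul (.const (1 / 12))
    p2))).congr_fun (f' := fun ε w => ε ^ 2 * (dg g 2 w / 12)) fun ε _ _ w => by ring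
  have hv := (HasExp.eps_mul he (HasExp.eps_mul he (HasExp.coeff_mul (.const (1 / 12))
    H2))).congr_fun (f' := fun ε w => ε ^ 2 * (iteratedDeriv 2 g (moveTarget g ε w) / 12))
    fun ε _ _ w => by ring
  have hu2 : PolyO e₀ 2 (fun ε w => ε ^ 2 * (dg g 2 w / 12)) :=
    ((PolyO.eps_pow 2).mul_right ((PolyO.const (1 / 12)).mul_left (p2.bound he))).congr
      fun ε _ _ w => by ring
  have hv2 : PolyO e₀ 2 (fun ε w => ε ^ 2 * (iteratedDeriv 2 g (moveTarget g ε w) / 12)) :=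
    ((PolyO.eps_pow 2).mul_right ((PolyO.const (1 / 12)).mul_left (H2.bound he))).congr
      fun ε _ _ w => by ring
  have hlogu := (((hu.add (HasExp.coeff_mul (.const (-1 / 2)) (hu.mul he hu))).congr_fun
    (f' := fun ε w => ε ^ 2 * (dg g 2 w / 12) - (ε ^ 2 * (dg g 2 w / 12)) ^ 2 / 2)
    fun ε _ _ w => by ring)).comp_of_abs_sub_le hu2 (φ := fun u => Real.log (1 + u)) (c := 2)
    fun ε h0 h1 w => abs_log_one_add_sub_le (abs_rescaled_le_half h0 h1 heM (hM _))
  have hlogv := (((hv.add (HasExp.coeff_mul (.const (-1 / 2)) (hv.mul he hv))).congr_fun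
    (f' := fun ε w => ε ^ 2 * (iteratedDeriv 2 g (moveTarget g ε w) / 12)
      - (ε ^ 2 * (iteratedDeriv 2 g (moveTarget g ε w) / 12)) ^ 2 / 2)
    fun ε _ _ w => by ring)).comp_of_abs_sub_le hv2 (φ := fun u => Real.log (1 + u)) (c := 2)
    fun ε h0 h1 w => abs_log_one_add_sub_le (abs_rescaled_le_half h0 h1 heM (hM _))
  have hinv := ((((HasExp.coeff (.const 1)).add (HasExp.coeff_mul (.const (-2)) hv)).add
    (HasExp.coeff_mul (.const 3) (hv.mul he hv))).congr_fun
    (f' := fun ε w => 1 - 2 * (ε ^ 2 * (iteratedDeriv 2 g (moveTarget g ε w) / 12))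
      + 3 * (ε ^ 2 * (iteratedDeriv 2 g (moveTarget g ε w) / 12)) ^ 2)
    fun ε _ _ w => by ring).comp_of_abs_sub_le hv2 (φ := fun u => ((1 + u) ^ 2)⁻¹) (c := 24)
    fun ε h0 h1 w => abs_inv_one_add_sq_sub_le (abs_rescaled_le_half h0 h1 heM (hM _))
  have hA := hasExp_reverseNoise he hg
  refine (((((H0.add hlogu).add (HasExp.coeff_mul (.const (-1)) hlogv)).add
    (HasExp.coeff_mul (.const (1 / 2)) (hz.mul he hz))).add
    (HasExp.coeff_mul (.const (-1 / 2)) ((hA.mul he hA).mul he hinv))).congr_fun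
      fun ε _ _ w => ?_).congr ?_ ?_ ?_ ?_ ?_ ?_
  · simp only [logRatio, dg, iteratedDeriv_zero]
    ring
  all_goals intro w; norm_num [leadCoeff]; try ring

end LogRatio

section Gaussian

section Density

variable {α E : Type*} [MeasurableSpace α] {μ : Measure α} [NormedAddCommGroup E]
  [NormedSpace ℝ E]

lemma integral_withDensity_ofReal {f : α → ℝ} (hf : Measurable f) (h0 : ∀ x, 0 ≤ f x)
    (φ : α → E) :
    ∫ x, φ x ∂(μ.withDensity fun x => ENNReal.ofReal (f x)) = ∫ x, f x • φ x ∂μ := by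
  rw [integral_withDensity_eq_integral_toReal_smul hf.ennreal_ofReal (by simp)]
  simp only [ENNReal.toReal_ofReal (h0 _)]

lemma integrable_withDensity_ofReal_iff {f : α → ℝ} (hf : Measurable f) (h0 : ∀ x, 0 ≤ f x)
    {φ : α → E} :
    Integrable φ (μ.withDensity fun x => ENNReal.ofReal (f x)) ↔
      Integrable (fun x => f x • φ x) μ := by
  rw [integrable_withDensity_iff_integrable_smul' hf.ennreal_ofReal (by simp)]
  simp only [ENNReal.toReal_ofReal (h0 _)]

lemma isProbabilityMeasure_withDensity_ofReal {f : α → ℝ} (hi : Integrable f μ)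
    (h0 : ∀ x, 0 ≤ f x) (h1 : ∫ x, f x ∂μ = 1) :
    IsProbabilityMeasure (μ.withDensity fun x => ENNReal.ofReal (f x)) := by
  constructor
  rw [withDensity_apply _ MeasurableSet.univ, Measure.restrict_univ,
    ← ofReal_integral_eq_lintegral_ofReal hi (ae_of_all _ h0), h1, ENNReal.ofReal_one]

end Density

section GaussianMoments

lemma integrable_pow_gaussianReal (n : ℕ) :
    Integrable (fun z : ℝ => z ^ n) (gaussianReal 0 1) := by
  have h : MemLp id n (gaussianReal 0 1) := memLp_id_gaussianReal n
  have h2 := h.integrable_norm_pow'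
  exact h2.mono' (by fun_prop) (ae_of_all _ fun z => by simp)

lemma integrable_pow_mul_gaussianPDFReal (n : ℕ) :
    Integrable (fun z : ℝ => z ^ n * gaussianPDFReal 0 1 z) := by
  have h := integrable_pow_gaussianReal n
  rw [gaussianReal_of_var_ne_zero 0 one_ne_zero] at h
  have := (integrable_withDensity_ofReal_iff (measurable_gaussianPDFReal 0 1)
    (gaussianPDFReal_nonneg 0 1)).1 h
  simpa [mul_comm] using this

lemma hasDerivAt_gaussianPDFReal (z : ℝ) :
    HasDerivAt (gaussianPDFReal 0 1) (-(z * gaussianPDFReal 0 1 z)) z := by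
  have h : HasDerivAt (fun z : ℝ => -(z - 0) ^ 2 / (2 * (1 : ℝ≥0))) (-z) z := by
    have := ((((hasDerivAt_id z).sub_const 0).pow 2).neg).div_const (2 * ((1 : ℝ≥0) : ℝ))
    convert! this using 1
    simp
    ring
  rw [gaussianPDFReal_def]
  convert! (h.exp).const_mul ((Real.sqrt (2 * Real.pi * (1 : ℝ≥0)))⁻¹) using 1
  ring

lemma integral_pow_add_two_gaussianReal (n : ℕ) :
    ∫ z, z ^ (n + 2) ∂(gaussianReal 0 1) = (n + 1) * ∫ z, z ^ n ∂(gaussianReal 0 1) := by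
  rw [integral_gaussianReal_eq_integral_smul one_ne_zero,
    integral_gaussianReal_eq_integral_smul one_ne_zero, ← integral_const_mul]
  have hu (z : ℝ) : HasDerivAt (fun z : ℝ => z ^ (n + 1)) ((n + 1) * z ^ n) z := by
    simpa using hasDerivAt_pow (n + 1) z
  have h := integral_mul_deriv_eq_deriv_mul_of_integrable (u := fun z : ℝ => z ^ (n + 1))
    (v := gaussianPDFReal 0 1) (fun z _ => hu z) (fun z _ => hasDerivAt_gaussianPDFReal z)
    ((integrable_pow_mul_gaussianPDFReal (n + 2)).neg.congr
      (ae_of_all _ fun z => by simp only [Pi.neg_apply, Pi.mul_apply]; ring))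
    (((integrable_pow_mul_gaussianPDFReal n).const_mul (n + 1)).congr
      (ae_of_all _ fun z => by simp only [Pi.mul_apply]; ring))
    (integrable_pow_mul_gaussianPDFReal (n + 1))
  simp only [smul_eq_mul]
  rw [← neg_eq_iff_eq_neg, ← integral_neg] at h
  refine (integral_congr_ae (ae_of_all _ fun z => ?_)).trans
    (h.trans (integral_congr_ae (ae_of_all _ fun z => ?_)))
  all_goals beta_reduce; ring

end GaussianMoments

end Gaussian

section Target

variable {g : ℝ → ℝ}

/-- The normalised one-dimensional target density. -/
noncomputable def targetPDF (g : ℝ → ℝ) (x : ℝ) : ℝ := Real.exp (g x) / ∫ t, Real.exp (g t)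

/-- The one-dimensional target distribution. -/
noncomputable def targetMeasure (g : ℝ → ℝ) : Measure ℝ :=
  volume.withDensity fun x => ENNReal.ofReal (targetPDF g x)

/-- The joint law of the current position and the Gaussian noise of a one-dimensional move. -/
noncomputable def noiseMeasure (g : ℝ → ℝ) : Measure (ℝ × ℝ) :=
  (targetMeasure g).prod (gaussianReal 0 1)

lemma integrable_exp_of_assumptionG (hg : AssumptionG g) :
    Integrable (fun t => Real.exp (g t)) := by
  simpa using hg.2.2.2 0

lemma integral_exp_pos_of_assumptionG (hg : AssumptionG g) : 0 < ∫ t, Real.exp (g t) :=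
  integral_exp_pos (integrable_exp_of_assumptionG hg)

lemma targetPDF_pos (hg : AssumptionG g) (x : ℝ) : 0 < targetPDF g x :=
  div_pos (Real.exp_pos _) (integral_exp_pos_of_assumptionG hg)

lemma continuous_targetPDF (hg : AssumptionG g) : Continuous (targetPDF g) :=
  (Real.continuous_exp.comp hg.1.continuous).div_const _

lemma integrable_targetPDF (hg : AssumptionG g) : Integrable (targetPDF g) :=
  (integrable_exp_of_assumptionG hg).div_const _

lemma integral_targetPDF (hg : AssumptionG g) : ∫ x, targetPDF g x = 1 := by
  simp only [targetPDF]
  rw [integral_div, div_self (integral_exp_pos_of_assumptionG hg).ne']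

lemma isProbabilityMeasure_targetMeasure (hg : AssumptionG g) :
    IsProbabilityMeasure (targetMeasure g) :=
  isProbabilityMeasure_withDensity_ofReal (integrable_targetPDF hg)
    (fun x => (targetPDF_pos hg x).le) (integral_targetPDF hg)

lemma integrable_pow_targetMeasure (hg : AssumptionG g) (n : ℕ) :
    Integrable (fun x : ℝ => x ^ n) (targetMeasure g) := by
  refine (integrable_withDensity_ofReal_iff (continuous_targetPDF hg).measurable
    (fun x => (targetPDF_pos hg x).le)).2 ?_
  refine ((hg.2.2.2 n).div_const (∫ t, Real.exp (g t))).congr (ae_of_all _ fun x => ?_)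
  simp only [targetPDF, smul_eq_mul]
  ring

lemma integrable_one_add_abs_pow {μ : Measure ℝ} [IsFiniteMeasure μ]
    (h : ∀ n : ℕ, Integrable (fun x : ℝ => x ^ n) μ) (N : ℕ) :
    Integrable (fun x : ℝ => (1 + |x|) ^ N) μ := by
  have hb : Integrable (fun x : ℝ => 2 ^ (N - 1) * (1 ^ N + |x| ^ N)) μ := by
    refine Integrable.const_mul ((integrable_const _).add ?_) _
    simpa only [abs_pow] using (h N).abs
  refine hb.mono' (by fun_prop) (ae_of_all _ fun x => ?_)
  rw [Real.norm_of_nonneg (by positivity)]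
  exact add_pow_le zero_le_one (abs_nonneg x) N

lemma integrable_weight_pow (hg : AssumptionG g) (N : ℕ) :
    Integrable (fun w : ℝ × ℝ => (1 + |w.1| + |w.2|) ^ N) (noiseMeasure g) := by
  have := isProbabilityMeasure_targetMeasure hg
  have h1 := integrable_one_add_abs_pow (integrable_pow_targetMeasure hg) N
  have h2 := integrable_one_add_abs_pow integrable_pow_gaussianReal N
  refine (h1.mul_prod h2).mono' (by fun_prop) (ae_of_all _ fun w => ?_)
  have ha := abs_nonneg w.1
  have hb := abs_nonneg w.2
  rw [Real.norm_of_nonneg (by positivity), ← mul_pow]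
  gcongr
  nlinarith [mul_nonneg ha hb]

lemma continuous_iteratedDeriv_of_assumptionG (hg : AssumptionG g) {k : ℕ} (hk : k ≤ 10) :
    Continuous (iteratedDeriv k g) :=
  hg.1.continuous_iteratedDeriv k (by exact_mod_cast hk)

lemma continuous_dg (hg : AssumptionG g) {k : ℕ} (hk : k ≤ 10) : Continuous (dg g k) :=
  (continuous_iteratedDeriv_of_assumptionG hg hk).comp continuous_fst

lemma continuous_leadCoeff (hg : AssumptionG g) : Continuous (leadCoeff g) := by
  have h1 := continuous_dg hg (k := 1) (by norm_num)
  have h2 := continuous_dg hg (k := 2) (by norm_num)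
  have h3 := continuous_dg hg (k := 3) (by norm_num)
  have h4 := continuous_dg hg (k := 4) (by norm_num)
  have h5 := continuous_dg hg (k := 5) (by norm_num)
  unfold leadCoeff
  fun_prop

lemma leadCoeff_neg (x z : ℝ) : leadCoeff g (x, -z) = -leadCoeff g (x, z) := by
  simp only [leadCoeff, dg]
  ring

lemma exists_small_step (hg : AssumptionG g) :
    ∃ e₀ M : ℝ, 0 < e₀ ∧ e₀ ≤ 1 ∧ (∀ t, |iteratedDeriv 2 g t| ≤ M) ∧ e₀ ^ 2 * M ≤ 6 := by
  obtain ⟨M, hM⟩ := hg.2.1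
  have hM0 : 0 ≤ M := (abs_nonneg _).trans (hM 0)
  refine ⟨(1 + M)⁻¹, M, by positivity, inv_le_one_of_one_le₀ (by linarith), hM, ?_⟩
  have h1 : (1 + M)⁻¹ ^ 2 * M ≤ 1 := by
    rw [inv_pow, inv_mul_le_iff₀ (by positivity)]
    nlinarith
  linarith

lemma integrable_leadCoeff_sq (hg : AssumptionG g) :
    Integrable (fun w => leadCoeff g w ^ 2) (noiseMeasure g) := by
  obtain ⟨e₀, M, h0, h1, hM, heM⟩ := exists_small_step hg
  obtain ⟨C, N, hC, hb⟩ := ((hasExp_logRatio h1 hg hM heM).c₅).pow 2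
  refine ((integrable_weight_pow hg N).const_mul C).mono'
    ((continuous_leadCoeff hg).pow 2).aestronglyMeasurable (ae_of_all _ fun w => ?_)
  simpa using hb e₀ h0 le_rfl w

lemma integral_leadCoeff_sq_gaussian (x : ℝ) :
    ∫ z, leadCoeff g (x, z) ^ 2 ∂(gaussianReal 0 1) = kappaFun g x := by
  have m (n : ℕ) := integrable_pow_gaussianReal n
  have m0 : ∫ z, z ^ 0 ∂(gaussianReal 0 1) = (1 : ℝ) := by simp
  have m2 := integral_pow_add_two_gaussianReal 0
  have m4 := integral_pow_add_two_gaussianReal 2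
  have m6 := integral_pow_add_two_gaussianReal 4
  have m8 := integral_pow_add_two_gaussianReal 6
  have m10 := integral_pow_add_two_gaussianReal 8
  norm_num at m2 m4 m6 m8 m10
  rw [m2] at m4
  rw [m4] at m6
  rw [m6] at m8
  rw [m8] at m10
  have key (a b c : ℝ) : ∫ z, (z * a + z ^ 3 * b + z ^ 5 * c) ^ 2 ∂(gaussianReal 0 1)
      = a ^ 2 + 6 * (a * b) + 15 * (b ^ 2 + 2 * a * c) + 210 * (b * c) + 945 * c ^ 2 := by
    have he : ∀ z : ℝ, (z * a + z ^ 3 * b + z ^ 5 * c) ^ 2 = a ^ 2 * z ^ 2 + 2 * a * b * z ^ 4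
        + (b ^ 2 + 2 * a * c) * z ^ 6 + 2 * b * c * z ^ 8 + c ^ 2 * z ^ 10 := fun z => by ring
    simp only [he]
    rw [integral_add (by fun_prop) (by fun_prop), integral_add (by fun_prop) (by fun_prop),
      integral_add (by fun_prop) (by fun_prop), integral_add (by fun_prop) (by fun_prop)]
    simp only [integral_const_mul, m2, m4, m6, m8, m10]
    ring
  simp only [leadCoeff, key, kappaFun, dg, iteratedDeriv_one]
  ring

lemma integral_leadCoeff_sq (hg : AssumptionG g) :
    ∫ w, leadCoeff g w ^ 2 ∂(noiseMeasure g)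
      = (∫ t, kappaFun g t * Real.exp (g t)) / ∫ t, Real.exp (g t) := by
  have := isProbabilityMeasure_targetMeasure hg
  rw [noiseMeasure, integral_prod _ (integrable_leadCoeff_sq hg)]
  simp only [integral_leadCoeff_sq_gaussian]
  rw [targetMeasure, integral_withDensity_ofReal (continuous_targetPDF hg).measurable
    (fun x => (targetPDF_pos hg x).le), ← integral_div]
  refine integral_congr_ae (ae_of_all _ fun x => ?_)
  simp only [targetPDF, smul_eq_mul]
  ring

/-- By oddness in the noise, the negative part of `leadCoeff` carries half of its second
moment. -/
lemma integral_min_leadCoeff_sq (hg : AssumptionG g) :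
    ∫ w, min (leadCoeff g w) 0 ^ 2 ∂(noiseMeasure g)
      = (∫ w, leadCoeff g w ^ 2 ∂(noiseMeasure g)) / 2 := by
  have := isProbabilityMeasure_targetMeasure hg
  have hneg : MeasurePreserving (fun z : ℝ => -z) (gaussianReal 0 1) (gaussianReal 0 1) :=
    ⟨measurable_neg, by simpa using gaussianReal_map_neg (μ := 0) (v := 1)⟩
  have hpres : MeasurePreserving (Prod.map id (fun z : ℝ => -z)) (noiseMeasure g)
      (noiseMeasure g) := (MeasurePreserving.id (targetMeasure g)).prod hneg
  have hcont := continuous_leadCoeff hg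
  have hInt : Integrable (fun w => min (leadCoeff g w) 0 ^ 2) (noiseMeasure g) := by
    refine (integrable_leadCoeff_sq hg).mono' (by fun_prop) (ae_of_all _ fun w => ?_)
    rw [Real.norm_of_nonneg (sq_nonneg _)]
    rcases le_total (leadCoeff g w) 0 with h | h <;> simp [h]
  have hemb : MeasurableEmbedding (Prod.map id (fun z : ℝ => -z) : ℝ × ℝ → ℝ × ℝ) :=
    ((MeasurableEquiv.refl ℝ).prodCongr (MeasurableEquiv.neg ℝ)).measurableEmbedding
  have hswap := hpres.integral_comp hemb (fun w => min (leadCoeff g w) 0 ^ 2)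
  have hInt' : Integrable
      (fun w => min (leadCoeff g (Prod.map id (fun z : ℝ => -z) w)) 0 ^ 2) (noiseMeasure g) :=
    (hpres.integrable_comp_emb hemb).2 hInt
  have hsum : ∫ w, leadCoeff g w ^ 2 ∂(noiseMeasure g)
      = ∫ w, (min (leadCoeff g w) 0 ^ 2
        + min (leadCoeff g (Prod.map id (fun z : ℝ => -z) w)) 0 ^ 2) ∂(noiseMeasure g) := by
    refine integral_congr_ae (ae_of_all _ fun w => ?_)
    obtain ⟨x, z⟩ := w
    simp only [Prod.map_apply, id, leadCoeff_neg]
    rcases le_total (leadCoeff g (x, z)) 0 with h | h <;> simp [h]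
  rw [hsum, integral_add hInt hInt', hswap]
  ring

end Target

section Pair

variable {g : ℝ → ℝ} {ε : ℝ}

/-- The mean of the one-dimensional fMALA proposal with step `ε²`. -/
noncomputable def proposalMean (g : ℝ → ℝ) (ε x : ℝ) : ℝ :=
  x + ε ^ 2 / 2 * deriv g x
    - (ε ^ 2) ^ 2 / 24 * (iteratedDeriv 2 g x * deriv g x + iteratedDeriv 3 g x)

/-- The standard deviation of the one-dimensional fMALA proposal with step `ε²`. -/
noncomputable def proposalScale (g : ℝ → ℝ) (ε x : ℝ) : ℝ :=
  ε * (1 + ε ^ 2 / 12 * iteratedDeriv 2 g x)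

lemma proposalScale_pos (hε : 0 < ε) (hs : ∀ t, 0 < 1 + ε ^ 2 / 12 * iteratedDeriv 2 g t)
    (x : ℝ) : 0 < proposalScale g ε x :=
  mul_pos hε (hs x)

lemma fmalaDensity1_eq (hε : 0 < ε) (x y : ℝ) :
    fmalaDensity1 g (ε ^ 2) x y = (Real.sqrt (2 * Real.pi) * proposalScale g ε x)⁻¹
      * Real.exp (-(y - proposalMean g ε x) ^ 2 / (2 * proposalScale g ε x ^ 2)) := by
  simp only [fmalaDensity1, Real.sqrt_sq hε.le, proposalMean, proposalScale]

lemma fmalaDensity1_pos (hε : 0 < ε) (hs : ∀ t, 0 < 1 + ε ^ 2 / 12 * iteratedDeriv 2 g t)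
    (x y : ℝ) : 0 < fmalaDensity1 g (ε ^ 2) x y := by
  have := proposalScale_pos hε hs x
  rw [fmalaDensity1_eq hε]
  positivity

lemma fmalaDensity1_eq_gaussianPDFReal (hε : 0 < ε)
    (hs : ∀ t, 0 < 1 + ε ^ 2 / 12 * iteratedDeriv 2 g t) (x y : ℝ) :
    fmalaDensity1 g (ε ^ 2) x y
      = gaussianPDFReal (proposalMean g ε x) (NNReal.mk (proposalScale g ε x ^ 2) (sq_nonneg _))
        y := by
  rw [fmalaDensity1_eq hε, gaussianPDFReal, NNReal.coe_mk,
    Real.sqrt_mul (x := 2 * Real.pi) (by positivity), Real.sqrt_sq (proposalScale_pos hε hs x).le]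

lemma measurable_proposalMean (hg : AssumptionG g) (ε : ℝ) : Measurable (proposalMean g ε) := by
  have h1 := (continuous_iteratedDeriv_of_assumptionG hg (k := 1) (by norm_num)).measurable
  have h2 := (continuous_iteratedDeriv_of_assumptionG hg (k := 2) (by norm_num)).measurable
  have h3 := (continuous_iteratedDeriv_of_assumptionG hg (k := 3) (by norm_num)).measurable
  rw [iteratedDeriv_one] at h1
  unfold proposalMean
  fun_prop

lemma measurable_proposalScale (hg : AssumptionG g) (ε : ℝ) :
    Measurable (proposalScale g ε) := by
  have h2 := (continuous_iteratedDeriv_of_assumptionG hg (k := 2) (by norm_num)).measurable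
  unfold proposalScale
  fun_prop

lemma moveTarget_eq (g : ℝ → ℝ) (ε : ℝ) (w : ℝ × ℝ) :
    moveTarget g ε w = proposalMean g ε w.1 + proposalScale g ε w.1 * w.2 := by
  simp only [moveTarget, moveIncrement, proposalMean, proposalScale, dg, iteratedDeriv_one]
  ring

lemma measurable_moveTarget (hg : AssumptionG g) (ε : ℝ) : Measurable (moveTarget g ε) := by
  have h1 := measurable_proposalMean hg ε
  have h2 := measurable_proposalScale hg ε
  have : moveTarget g ε = fun w => proposalMean g ε w.1 + proposalScale g ε w.1 * w.2 :=
    funext (moveTarget_eq g ε)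
  rw [this]
  fun_prop

/-- The joint density of the current position and the proposal in one dimension. -/
noncomputable def pairDensity (g : ℝ → ℝ) (h : ℝ) (w : ℝ × ℝ) : ℝ :=
  targetPDF g w.1 * fmalaDensity1 g h w.1 w.2

lemma pairDensity_pos (hg : AssumptionG g) (hε : 0 < ε)
    (hs : ∀ t, 0 < 1 + ε ^ 2 / 12 * iteratedDeriv 2 g t) (w : ℝ × ℝ) :
    0 < pairDensity g (ε ^ 2) w :=
  mul_pos (targetPDF_pos hg _) (fmalaDensity1_pos hε hs _ _)

lemma measurable_pairDensity (hg : AssumptionG g) (hε : 0 < ε) :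
    Measurable (pairDensity g (ε ^ 2)) := by
  have h1 := measurable_proposalMean hg ε
  have h2 := measurable_proposalScale hg ε
  have h3 := (continuous_targetPDF hg).measurable
  have : pairDensity g (ε ^ 2) = fun w => targetPDF g w.1 *
      ((Real.sqrt (2 * Real.pi) * proposalScale g ε w.1)⁻¹
      * Real.exp (-(w.2 - proposalMean g ε w.1) ^ 2 / (2 * proposalScale g ε w.1 ^ 2))) :=
    funext fun w => by rw [pairDensity, fmalaDensity1_eq hε]
  rw [this]
  fun_prop

/-- The joint law of the current position and the proposal in one dimension. -/
noncomputable def pairMeasure (g : ℝ → ℝ) (h : ℝ) : Measure (ℝ × ℝ) :=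
  volume.withDensity fun w => ENNReal.ofReal (pairDensity g h w)

lemma map_affine_gaussianReal (m s : ℝ) :
    (gaussianReal 0 1).map (fun z => m + s * z)
      = gaussianReal m (NNReal.mk (s ^ 2) (sq_nonneg s)) := by
  have h : (fun z : ℝ => m + s * z) = (fun x => m + x) ∘ (fun z => s * z) := rfl
  rw [h, ← Measure.map_map (by fun_prop) (by fun_prop), gaussianReal_map_const_mul,
    gaussianReal_map_const_add]
  simp

lemma pairMeasure_eq_map (hg : AssumptionG g) (hε : 0 < ε)
    (hs : ∀ t, 0 < 1 + ε ^ 2 / 12 * iteratedDeriv 2 g t) :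
    pairMeasure g (ε ^ 2) = (noiseMeasure g).map (fun w => (w.1, moveTarget g ε w)) := by
  have := isProbabilityMeasure_targetMeasure hg
  have hmt := measurable_moveTarget hg ε
  have hm : Measurable (fun w : ℝ × ℝ => (w.1, moveTarget g ε w)) := by fun_prop
  have hd := measurable_pairDensity hg hε
  ext s hs'
  rw [Measure.map_apply hm hs', noiseMeasure, Measure.prod_apply (hm hs'), targetMeasure,
    lintegral_withDensity_eq_lintegral_mul _ (continuous_targetPDF hg).measurable.ennreal_ofReal
      (measurable_measure_prodMk_left (hm hs')), pairMeasure, withDensity_apply _ hs',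
    ← lintegral_indicator hs', Measure.volume_eq_prod,
    lintegral_prod _ ((hd.ennreal_ofReal.indicator hs').aemeasurable)]
  refine lintegral_congr fun x => ?_
  have hx := proposalScale_pos hε hs x
  have hsec : MeasurableSet (Prod.mk x ⁻¹' s) := measurable_prodMk_left hs'
  have hpre : Prod.mk x ⁻¹' ((fun w : ℝ × ℝ => (w.1, moveTarget g ε w)) ⁻¹' s)
      = (fun z => proposalMean g ε x + proposalScale g ε x * z) ⁻¹' (Prod.mk x ⁻¹' s) := by
    ext z
    simp [moveTarget_eq]
  have hv : NNReal.mk (proposalScale g ε x ^ 2) (sq_nonneg _) ≠ 0 := by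
    intro h
    have := congrArg NNReal.toReal h
    simp at this
    exact hx.ne' this
  rw [Pi.mul_apply, hpre, ← Measure.map_apply (by fun_prop) hsec, map_affine_gaussianReal,
    gaussianReal_apply _ hv, ← lintegral_const_mul _ (measurable_gaussianPDF _ _),
    ← lintegral_indicator hsec]
  refine lintegral_congr fun y => ?_
  by_cases hy : (x, y) ∈ s
  · rw [Set.indicator_of_mem hy, Set.indicator_of_mem (by exact hy), pairDensity,
      ENNReal.ofReal_mul (targetPDF_pos hg x).le, fmalaDensity1_eq_gaussianPDFReal hε hs,
      gaussianPDF]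
  · rw [Set.indicator_of_notMem hy, Set.indicator_of_notMem (by exact hy)]

lemma isProbabilityMeasure_pairMeasure (hg : AssumptionG g) (hε : 0 < ε)
    (hs : ∀ t, 0 < 1 + ε ^ 2 / 12 * iteratedDeriv 2 g t) :
    IsProbabilityMeasure (pairMeasure g (ε ^ 2)) := by
  have := isProbabilityMeasure_targetMeasure hg
  have hmt := measurable_moveTarget hg ε
  rw [pairMeasure_eq_map hg hε hs, noiseMeasure]
  exact Measure.isProbabilityMeasure_map (by fun_prop)

/-- The log acceptance ratio of a one-dimensional move from `w.1` to `w.2`. -/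
noncomputable def pairLogRatio (g : ℝ → ℝ) (h : ℝ) (w : ℝ × ℝ) : ℝ :=
  Real.log (pairDensity g h w.swap / pairDensity g h w)

lemma measurable_pairLogRatio (hg : AssumptionG g) (hε : 0 < ε) :
    Measurable (pairLogRatio g (ε ^ 2)) := by
  have hd := measurable_pairDensity hg hε
  unfold pairLogRatio
  fun_prop

lemma pairLogRatio_swap (g : ℝ → ℝ) (h : ℝ) (w : ℝ × ℝ) :
    pairLogRatio g h w.swap = -pairLogRatio g h w := by
  rw [pairLogRatio, pairLogRatio, Prod.swap_swap, ← Real.log_inv, inv_div]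

lemma pairDensity_swap (hg : AssumptionG g) (hε : 0 < ε)
    (hs : ∀ t, 0 < 1 + ε ^ 2 / 12 * iteratedDeriv 2 g t) (w : ℝ × ℝ) :
    pairDensity g (ε ^ 2) w.swap
      = pairDensity g (ε ^ 2) w * Real.exp (pairLogRatio g (ε ^ 2) w) := by
  have h1 := pairDensity_pos hg hε hs w
  have h2 := pairDensity_pos hg hε hs w.swap
  rw [pairLogRatio, Real.exp_log (div_pos h2 h1)]
  field_simp

lemma log_pairDensity (hg : AssumptionG g) (hε : 0 < ε)
    (hs : ∀ t, 0 < 1 + ε ^ 2 / 12 * iteratedDeriv 2 g t) (w : ℝ × ℝ) :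
    Real.log (pairDensity g (ε ^ 2) w) = g w.1 - Real.log (∫ t, Real.exp (g t))
      - Real.log (Real.sqrt (2 * Real.pi)) - Real.log ε
      - Real.log (1 + ε ^ 2 / 12 * iteratedDeriv 2 g w.1)
      - (w.2 - proposalMean g ε w.1) ^ 2 / (2 * proposalScale g ε w.1 ^ 2) := by
  have hx := proposalScale_pos hε hs w.1
  have hZ := integral_exp_pos_of_assumptionG hg
  have h2 : Real.sqrt (2 * Real.pi) ≠ 0 := by positivity
  rw [pairDensity, targetPDF, fmalaDensity1_eq hε, Real.log_mul (by positivity) (by positivity),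
    Real.log_div (by positivity) hZ.ne', Real.log_exp,
    Real.log_mul (by positivity) (by positivity), Real.log_inv,
    Real.log_mul h2 hx.ne', Real.log_exp, proposalScale, Real.log_mul hε.ne' (hs _).ne']
  ring

lemma pairLogRatio_moveTarget (hg : AssumptionG g) (hε : 0 < ε)
    (hs : ∀ t, 0 < 1 + ε ^ 2 / 12 * iteratedDeriv 2 g t) (w : ℝ × ℝ) :
    pairLogRatio g (ε ^ 2) (w.1, moveTarget g ε w) = logRatio g ε w := by
  rw [pairLogRatio, Real.log_div (pairDensity_pos hg hε hs _).ne'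
    (pairDensity_pos hg hε hs _).ne', log_pairDensity hg hε hs, log_pairDensity hg hε hs,
    logRatio]
  have hfwd : (moveTarget g ε w - proposalMean g ε w.1) ^ 2 / (2 * proposalScale g ε w.1 ^ 2)
      = w.2 ^ 2 / 2 := by
    have hx := proposalScale_pos hε hs w.1
    rw [moveTarget_eq]
    field_simp
    ring
  have hrev : w.1 - proposalMean g ε (moveTarget g ε w) = -(ε * reverseNoise g ε w) := by
    rw [reverseNoise, proposalMean, iteratedDeriv_one]
    generalize deriv g (moveTarget g ε w) = a
    generalize iteratedDeriv 2 g (moveTarget g ε w) = b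
    generalize iteratedDeriv 3 g (moveTarget g ε w) = c
    rw [moveTarget, moveIncrement]
    ring
  have hy := hs (moveTarget g ε w)
  have hbwd : (w.1 - proposalMean g ε (moveTarget g ε w)) ^ 2
      / (2 * proposalScale g ε (moveTarget g ε w) ^ 2) = reverseNoise g ε w ^ 2 / 2
        * ((1 + ε ^ 2 / 12 * iteratedDeriv 2 g (moveTarget g ε w)) ^ 2)⁻¹ := by
    rw [hrev, proposalScale, mul_pow, neg_sq, mul_pow]
    generalize 1 + ε ^ 2 / 12 * iteratedDeriv 2 g (moveTarget g ε w) = c at hy ⊢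
    field_simp
  have hc (t : ℝ) : 1 + ε ^ 2 * (t / 12) = 1 + ε ^ 2 / 12 * t := by ring
  simp only [Prod.swap_prod_mk, hfwd, hbwd, hc, dg]
  ring

end Pair

section OneDimensional

variable {g : ℝ → ℝ} {ε : ℝ}

/-- The function obtained by folding `r ↦ exp (i t r) - 1` onto the negative half-line along
the reversibility relation between `r` and `-r`. -/
noncomputable def foldedChar (t r : ℝ) : ℂ :=
  if r < 0 then (Complex.exp (t * Complex.I * r) - 1) * (1 - Complex.exp ((1 - t * Complex.I) * r))
  else 0

lemma measurable_foldedChar (t : ℝ) : Measurable (foldedChar t) := by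
  unfold foldedChar
  exact Measurable.ite measurableSet_Iio (by fun_prop) measurable_const

/-- Reversibility expresses the characteristic function of the log acceptance ratio through its
negative values. -/
lemma integral_exp_pairLogRatio (hg : AssumptionG g) (hε : 0 < ε)
    (hs : ∀ t, 0 < 1 + ε ^ 2 / 12 * iteratedDeriv 2 g t) (t : ℝ) :
    ∫ w, Complex.exp (t * Complex.I * pairLogRatio g (ε ^ 2) w) ∂(pairMeasure g (ε ^ 2)) =
      1 + ∫ w, foldedChar t (pairLogRatio g (ε ^ 2) w) ∂(pairMeasure g (ε ^ 2)) := by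
  have hP := isProbabilityMeasure_pairMeasure hg hε hs
  have hR := measurable_pairLogRatio hg hε
  have hd := measurable_pairDensity hg hε
  have hpos := pairDensity_pos hg hε hs
  have hd0 (w : ℝ × ℝ) : 0 ≤ pairDensity g (ε ^ 2) w := (hpos w).le
  set R := pairLogRatio g (ε ^ 2) with hRdef
  set f := pairDensity g (ε ^ 2) with hfdef
  have hnorm (r : ℝ) : ‖Complex.exp (t * Complex.I * r)‖ = 1 := by
    rw [Complex.norm_exp]; simp
  have hb (r : ℝ) : ‖Complex.exp (t * Complex.I * r) - 1‖ ≤ 2 := by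
    refine (norm_sub_le _ _).trans ?_
    rw [hnorm, norm_one]; norm_num
  have hbdd (φ : ℝ → ℂ) (hφ : Measurable φ) (h2 : ∀ r, ‖φ r‖ ≤ 2) :
      Integrable (fun w => φ (R w)) (pairMeasure g (ε ^ 2)) :=
    (integrable_const (2 : ℝ)).mono' (hφ.comp hR).aestronglyMeasurable (ae_of_all _ fun w => h2 _)
  have hneg := hbdd (fun r => if r < 0 then Complex.exp (t * Complex.I * r) - 1 else 0)
    (Measurable.ite measurableSet_Iio (by fun_prop) measurable_const)
    (fun r => by split_ifs <;> simp [hb])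
  have hposi := hbdd (fun r => if 0 < r then Complex.exp (t * Complex.I * r) - 1 else 0)
    (Measurable.ite measurableSet_Ioi (by fun_prop) measurable_const)
    (fun r => by split_ifs <;> simp [hb])
  have hfold := hbdd (fun r => if r < 0 then
      Real.exp r * (Complex.exp (-(t * Complex.I * r)) - 1) else 0)
    (Measurable.ite measurableSet_Iio (by fun_prop) measurable_const) (fun r => by
      split_ifs with h
      · rw [norm_mul, Complex.norm_real, Real.norm_of_nonneg (Real.exp_pos r).le]
        have h1 : Real.exp r ≤ 1 := Real.exp_le_one_iff.2 h.le
        have h2 := hb (-r)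
        push_cast at h2
        rw [mul_neg] at h2
        nlinarith [Real.exp_pos r, norm_nonneg (Complex.exp (-(t * Complex.I * r)) - 1)]
      · simp)
  have hswap : ∫ w, (if 0 < R w then Complex.exp (t * Complex.I * R w) - 1 else 0)
      ∂(pairMeasure g (ε ^ 2)) = ∫ w, (if R w < 0 then
      Real.exp (R w) * (Complex.exp (-(t * Complex.I * R w)) - 1) else 0)
      ∂(pairMeasure g (ε ^ 2)) := by
    rw [pairMeasure, integral_withDensity_ofReal hd hd0, integral_withDensity_ofReal hd hd0,
      Measure.volume_eq_prod, ← (Measure.measurePreserving_swap (μ := (volume : Measure ℝ))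
        (ν := (volume : Measure ℝ))).integral_comp
        MeasurableEquiv.prodComm.measurableEmbedding]
    refine integral_congr_ae (ae_of_all _ fun w => ?_)
    have h1 := pairDensity_swap hg hε hs w
    have h2 := pairLogRatio_swap g (ε ^ 2) w
    simp only [← hRdef, ← hfdef] at h1 h2
    simp only [h1, h2, Left.neg_pos_iff]
    split_ifs with h
    · simp only [Complex.real_smul]
      push_cast
      rw [mul_neg]
      ring
    · simp
  have hone : ∫ w, Complex.exp (t * Complex.I * R w) ∂(pairMeasure g (ε ^ 2)) - 1
      = ∫ w, (Complex.exp (t * Complex.I * R w) - 1) ∂(pairMeasure g (ε ^ 2)) := by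
    rw [integral_sub (hbdd (fun r => Complex.exp (t * Complex.I * r)) (by fun_prop)
      (fun r => by rw [hnorm]; norm_num)) (integrable_const _)]
    simp
  rw [← sub_eq_iff_eq_add', hone]
  calc ∫ w, (Complex.exp (t * Complex.I * R w) - 1) ∂(pairMeasure g (ε ^ 2))
      = ∫ w, ((if R w < 0 then Complex.exp (t * Complex.I * R w) - 1 else 0)
        + (if 0 < R w then Complex.exp (t * Complex.I * R w) - 1 else 0))
          ∂(pairMeasure g (ε ^ 2)) := by
        refine integral_congr_ae (ae_of_all _ fun w => ?_)
        rcases lt_trichotomy (R w) 0 with h | h | h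
        · simp [h, not_lt.2 h.le]
        · simp [h]
        · simp [h, not_lt.2 h.le]
    _ = ∫ w, ((if R w < 0 then Complex.exp (t * Complex.I * R w) - 1 else 0)
        + (if R w < 0 then Real.exp (R w) * (Complex.exp (-(t * Complex.I * R w)) - 1) else 0))
          ∂(pairMeasure g (ε ^ 2)) := by
        rw [integral_add hneg hposi, hswap, ← integral_add hneg hfold]
    _ = ∫ w, foldedChar t (R w) ∂(pairMeasure g (ε ^ 2)) := by
        refine integral_congr_ae (ae_of_all _ fun w => ?_)
        simp only [foldedChar]
        split_ifs with h
        · have : Complex.exp ((1 - t * Complex.I) * R w)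
              = Complex.exp (R w) * Complex.exp (-(t * Complex.I * R w)) := by
            rw [← Complex.exp_add]; ring_nf
          have h' : Complex.exp (t * Complex.I * R w)
              * Complex.exp (-(t * Complex.I * R w)) = 1 := by
            rw [← Complex.exp_add, add_neg_cancel, Complex.exp_zero]
          rw [this]
          push_cast
          linear_combination Complex.exp (R w) * h'
        · simp

lemma hasDerivAt_cexp_mul_ofReal (c : ℂ) (r : ℝ) :
    HasDerivAt (fun r : ℝ => Complex.exp (c * r)) (c * Complex.exp (c * r)) r := by
  have h := ((hasDerivAt_id r).ofReal_comp.const_mul c).cexp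
  convert! h using 1
  simp [mul_comm]

lemma norm_cexp_mul_sub_one_le {c : ℂ} (hc : 0 ≤ c.re) {r : ℝ} (hr : r ≤ 0) :
    ‖Complex.exp (c * r) - 1‖ ≤ ‖c‖ * |r| := by
  have h := Convex.norm_image_sub_le_of_norm_hasDerivWithin_le (s := Set.Iic (0 : ℝ))
    (f := fun r : ℝ => Complex.exp (c * r)) (f' := fun r : ℝ => c * Complex.exp (c * r))
    (C := ‖c‖) (x := 0) (y := r) (fun x _ => (hasDerivAt_cexp_mul_ofReal c x).hasDerivWithinAt)
    (fun x hx => ?_) (convex_Iic 0) (by simp) hr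
  · simpa using h
  · rw [norm_mul, Complex.norm_exp]
    refine mul_le_of_le_one_right (norm_nonneg c) (Real.exp_le_one_iff.2 ?_)
    simpa using mul_nonpos_of_nonneg_of_nonpos hc hx

lemma norm_foldedChar_le (t r : ℝ) :
    ‖foldedChar t r‖ ≤ ‖(t * Complex.I : ℂ)‖ * ‖(1 - t * Complex.I : ℂ)‖ * r ^ 2 := by
  unfold foldedChar
  split_ifs with h
  · rw [norm_mul, norm_sub_rev 1]
    have h1 := norm_cexp_mul_sub_one_le (c := t * Complex.I) (by simp) h.le
    have h2 := norm_cexp_mul_sub_one_le (c := 1 - t * Complex.I) (by simp) h.le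
    refine (mul_le_mul h1 h2 (norm_nonneg _) (by positivity)).trans_eq ?_
    rw [← sq_abs r]
    ring
  · simp only [norm_zero]
    positivity

lemma foldedChar_eq_dslope (t r : ℝ) :
    foldedChar t r = -((min r 0 ^ 2 : ℝ) : ℂ)
      * dslope (fun r : ℝ => Complex.exp (t * Complex.I * r)) 0 r
      * dslope (fun r : ℝ => Complex.exp ((1 - t * Complex.I) * r)) 0 r := by
  have h1 := sub_smul_dslope (fun r : ℝ => Complex.exp (t * Complex.I * r)) 0 r
  have h2 := sub_smul_dslope (fun r : ℝ => Complex.exp ((1 - t * Complex.I) * r)) 0 r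
  simp only [sub_zero, Complex.real_smul, Complex.ofReal_zero, mul_zero, Complex.exp_zero]
    at h1 h2
  unfold foldedChar
  split_ifs with h
  · rw [min_eq_left h.le, ← neg_sub (Complex.exp ((1 - t * Complex.I) * r)) 1, ← h1, ← h2]
    push_cast
    ring
  · simp [min_eq_right (not_lt.1 h)]

lemma tendsto_dslope_cexp (c : ℂ) :
    Tendsto (dslope (fun r : ℝ => Complex.exp (c * r)) 0) (nhds 0) (nhds c) := by
  have h := hasDerivAt_cexp_mul_ofReal c 0
  have hc := (continuousAt_dslope_same.2 h.differentiableAt).tendsto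
  rw [dslope_same, h.deriv] at hc
  simpa using hc

lemma one_add_pos_of_le {e₀ M : ℝ} (hM : ∀ t, |iteratedDeriv 2 g t| ≤ M)
    (heM : e₀ ^ 2 * M ≤ 6) (hε : 0 < ε) (hle : ε ≤ e₀) (t : ℝ) :
    0 < 1 + ε ^ 2 / 12 * iteratedDeriv 2 g t := by
  have hM0 : 0 ≤ M := (abs_nonneg _).trans (hM 0)
  have h1 : ε ^ 2 * M ≤ e₀ ^ 2 * M := by gcongr
  have h2 : -M ≤ iteratedDeriv 2 g t := neg_le_of_abs_le (hM t)
  nlinarith [mul_le_mul_of_nonneg_left h2 (sq_nonneg ε)]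

lemma measurable_logRatio (hg : AssumptionG g) (hε : 0 < ε)
    (hs : ∀ t, 0 < 1 + ε ^ 2 / 12 * iteratedDeriv 2 g t) : Measurable (logRatio g ε) := by
  have h1 := measurable_pairLogRatio hg hε
  have h2 := measurable_moveTarget hg ε
  have h : logRatio g ε = fun w => pairLogRatio g (ε ^ 2) (w.1, moveTarget g ε w) :=
    funext fun w => (pairLogRatio_moveTarget hg hε hs w).symm
  rw [h]
  fun_prop

lemma tendsto_integral_foldedChar (hg : AssumptionG g) (t : ℝ) :
    Tendsto (fun ε : ℝ => ∫ w, ((ε ^ 10)⁻¹ : ℝ) • foldedChar t (logRatio g ε w) ∂(noiseMeasure g))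
      (nhdsWithin 0 (Set.Ioi 0))
      (nhds (-(t * Complex.I * (1 - t * Complex.I))
        * ((∫ w, leadCoeff g w ^ 2 ∂(noiseMeasure g)) / 2 : ℝ))) := by
  obtain ⟨e₀, M, h0, h1, hM, heM⟩ := exists_small_step hg
  have hexp := hasExp_logRatio h1 hg hM heM
  have hev : ∀ᶠ ε in nhdsWithin (0 : ℝ) (Set.Ioi 0), 0 < ε ∧ ε ≤ e₀ := by
    filter_upwards [Ioo_mem_nhdsGT h0] with ε hε
    exact ⟨hε.1, hε.2.le⟩
  have hlim : -(t * Complex.I * (1 - t * Complex.I))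
        * ((∫ w, leadCoeff g w ^ 2 ∂(noiseMeasure g)) / 2 : ℝ)
      = ∫ w, -((min (leadCoeff g w) 0 ^ 2 : ℝ) : ℂ) * (t * Complex.I) * (1 - t * Complex.I)
        ∂(noiseMeasure g) := by
    rw [integral_mul_const, integral_mul_const, integral_neg, integral_complex_ofReal,
      integral_min_leadCoeff_sq hg]
    ring
  rw [hlim]
  obtain ⟨C₅, N₅, hC₅, hb₅⟩ := hexp.c₅
  obtain ⟨C₆, N₆, hC₆, hb₆⟩ := hexp.rem
  have hrem : ∀ ε, 0 < ε → ε ≤ e₀ → ∀ w, |logRatio g ε w / ε ^ 5 - leadCoeff g w|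
      ≤ C₆ * (1 + |w.1| + |w.2|) ^ N₆ * ε := by
    intro ε hε hle w
    have h := hb₆ ε hε hle w
    simp only [zero_mul, zero_add] at h
    have he : logRatio g ε w / ε ^ 5 - leadCoeff g w
        = (logRatio g ε w - leadCoeff g w * ε ^ 5) / ε ^ 5 := by field_simp
    rw [he, abs_div, abs_of_pos (pow_pos hε 5), div_le_iff₀ (pow_pos hε 5)]
    exact h.trans_eq (by ring)
  have hlead : ∀ w, |leadCoeff g w| ≤ C₅ * (1 + |w.1| + |w.2|) ^ N₅ := fun w => by
    simpa using hb₅ e₀ h0 le_rfl w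
  have hratio : ∀ ε, 0 < ε → ε ≤ e₀ → ∀ w, |logRatio g ε w / ε ^ 5|
      ≤ (C₅ + C₆) * (1 + |w.1| + |w.2|) ^ (N₅ + N₆) := by
    intro ε hε hle w
    have hw : 1 ≤ 1 + |w.1| + |w.2| := by linarith [abs_nonneg w.1, abs_nonneg w.2]
    have ha : (1 + |w.1| + |w.2|) ^ N₅ ≤ (1 + |w.1| + |w.2|) ^ (N₅ + N₆) :=
      pow_le_pow_right₀ hw (by omega)
    have hb : (1 + |w.1| + |w.2|) ^ N₆ ≤ (1 + |w.1| + |w.2|) ^ (N₅ + N₆) :=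
      pow_le_pow_right₀ hw (by omega)
    have hc : C₆ * (1 + |w.1| + |w.2|) ^ N₆ * ε ≤ C₆ * (1 + |w.1| + |w.2|) ^ (N₅ + N₆) * 1 := by
      gcongr
      exact hle.trans h1
    have hd : C₅ * (1 + |w.1| + |w.2|) ^ N₅ ≤ C₅ * (1 + |w.1| + |w.2|) ^ (N₅ + N₆) := by gcongr
    have h := abs_add_le (logRatio g ε w / ε ^ 5 - leadCoeff g w) (leadCoeff g w)
    rw [sub_add_cancel] at h
    linarith [hrem ε hε hle w, hlead w]
  refine tendsto_integral_filter_of_dominated_convergence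
    (fun w => ‖(t * Complex.I : ℂ)‖ * ‖(1 - t * Complex.I : ℂ)‖ *
      ((C₅ + C₆) ^ 2 * (1 + |w.1| + |w.2|) ^ ((N₅ + N₆) * 2))) ?_ ?_
    (((integrable_weight_pow hg _).const_mul _).const_mul _) ?_
  · filter_upwards [hev] with ε hε
    have h2 := measurable_logRatio hg hε.1 (one_add_pos_of_le hM heM hε.1 hε.2)
    exact (((measurable_foldedChar t).comp h2).const_smul ((ε ^ 10)⁻¹ : ℝ)).aestronglyMeasurable
  · filter_upwards [hev] with ε hε
    refine ae_of_all _ fun w => ?_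
    have hp := pow_pos hε.1 10
    rw [norm_smul, Real.norm_of_nonneg (inv_pos.2 hp).le, inv_mul_le_iff₀ hp]
    refine (norm_foldedChar_le t _).trans ?_
    have h := pow_le_pow_left₀ (abs_nonneg _) (hratio ε hε.1 hε.2 w) 2
    rw [sq_abs, mul_pow, ← pow_mul, div_pow, div_le_iff₀ (by have := hε.1; positivity)] at h
    rw [mul_left_comm]
    gcongr
    exact h.trans_eq (by ring)
  · refine ae_of_all _ fun w => ?_
    have hid : Tendsto (fun ε : ℝ => ε) (nhdsWithin 0 (Set.Ioi 0)) (nhds 0) :=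
      tendsto_nhdsWithin_of_tendsto_nhds tendsto_id
    have hρ : Tendsto (fun ε => logRatio g ε w / ε ^ 5) (nhdsWithin 0 (Set.Ioi 0))
        (nhds (leadCoeff g w)) := by
      rw [tendsto_iff_norm_sub_tendsto_zero]
      refine squeeze_zero' (Eventually.of_forall fun _ => norm_nonneg _)
        (hev.mono fun ε hε => hrem ε hε.1 hε.2 w) ?_
      simpa using hid.const_mul (C₆ * (1 + |w.1| + |w.2|) ^ N₆)
    have hR : Tendsto (fun ε => logRatio g ε w) (nhdsWithin 0 (Set.Ioi 0)) (nhds 0) := by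
      have h := hρ.mul (hid.pow 5)
      simp only [ne_eq, OfNat.ofNat_ne_zero, not_false_eq_true, zero_pow, mul_zero] at h
      refine h.congr' (hev.mono fun ε hε => ?_)
      have := hε.1
      field_simp
    have hmin : Tendsto (fun ε => -((min (logRatio g ε w / ε ^ 5) 0 ^ 2 : ℝ) : ℂ))
        (nhdsWithin 0 (Set.Ioi 0)) (nhds (-((min (leadCoeff g w) 0 ^ 2 : ℝ) : ℂ))) :=
      ((Complex.continuous_ofReal.tendsto _).comp ((hρ.min tendsto_const_nhds).pow 2)).neg
    refine ((hmin.mul ((tendsto_dslope_cexp _).comp hR)).mul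
      ((tendsto_dslope_cexp _).comp hR)).congr' (hev.mono fun ε hε => ?_)
    have hp := pow_pos hε.1 5
    have hm : min (logRatio g ε w / ε ^ 5) 0 = min (logRatio g ε w) 0 / ε ^ 5 := by
      rw [← min_div_div_right hp.le, zero_div]
    simp only [Function.comp_apply, Complex.real_smul, foldedChar_eq_dslope, hm]
    push_cast
    ring

end OneDimensional

section Limit

variable {g : ℝ → ℝ} {ε : ℝ}

/-- The mean of `min 1 (exp W)` for `W` normal with mean `-σ² / 2` and variance `σ²`. -/
lemma integral_min_one_exp_gaussianReal {σ : ℝ} (hσ : 0 ≤ σ) :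
    ∫ s, min 1 (Real.exp s) ∂(gaussianReal (-σ ^ 2 / 2) (NNReal.mk (σ ^ 2) (sq_nonneg σ)))
      = 2 * stdNormalCDF (-σ / 2) := by
  have hexp : Integrable (fun z : ℝ => Real.exp (-z ^ 2 / 2)) := by
    have h := integrable_exp_neg_mul_sq (b := 1 / 2) (by norm_num)
    exact h.congr (ae_of_all _ fun z => by ring_nf)
  rw [← map_affine_gaussianReal, integral_map (by fun_prop) (by fun_prop),
    integral_gaussianReal_eq_integral_smul one_ne_zero]
  have hpdf (z : ℝ) : gaussianPDFReal 0 1 z • min 1 (Real.exp (-σ ^ 2 / 2 + σ * z))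
      = (Real.sqrt (2 * Real.pi))⁻¹ *
        (Real.exp (-z ^ 2 / 2) * min 1 (Real.exp (-σ ^ 2 / 2 + σ * z))) := by
    simp [gaussianPDFReal, mul_assoc]
  have hInt : Integrable (fun z : ℝ =>
      Real.exp (-z ^ 2 / 2) * min 1 (Real.exp (-σ ^ 2 / 2 + σ * z))) := by
    refine hexp.mono' (by fun_prop) (ae_of_all _ fun z => ?_)
    rw [Real.norm_of_nonneg (by positivity)]
    exact mul_le_of_le_one_right (by positivity) (min_le_left _ _)
  simp only [hpdf]
  rw [integral_const_mul, ← intervalIntegral.integral_Iic_add_Ioi (b := σ / 2)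
    hInt.integrableOn hInt.integrableOn]
  have hright : ∫ z in Set.Ioi (σ / 2),
      Real.exp (-z ^ 2 / 2) * min 1 (Real.exp (-σ ^ 2 / 2 + σ * z))
      = ∫ z in Set.Iic (-σ / 2), Real.exp (-z ^ 2 / 2) := by
    have h := integral_comp_neg_Iic (-σ / 2) (fun z : ℝ => Real.exp (-z ^ 2 / 2))
    simp only [neg_sq, neg_div (2 : ℝ) σ, neg_neg] at h
    rw [neg_div (2 : ℝ) σ, h]
    refine setIntegral_congr_fun measurableSet_Ioi fun z hz => ?_
    have h0 : 0 ≤ -σ ^ 2 / 2 + σ * z := by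
      have : σ / 2 < z := hz
      nlinarith
    simp [min_eq_left (Real.one_le_exp h0)]
  have hleft : ∫ z in Set.Iic (σ / 2),
      Real.exp (-z ^ 2 / 2) * min 1 (Real.exp (-σ ^ 2 / 2 + σ * z))
      = ∫ z in Set.Iic (-σ / 2), Real.exp (-z ^ 2 / 2) := by
    have h := (measurePreserving_sub_right volume σ).setIntegral_preimage_emb
      (MeasurableEquiv.subRight σ).measurableEmbedding
      (fun z : ℝ => Real.exp (-z ^ 2 / 2)) (Set.Iic (-σ / 2))
    have hset : (fun z : ℝ => z - σ) ⁻¹' Set.Iic (-σ / 2) = Set.Iic (σ / 2) := by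
      ext z
      simp only [Set.mem_preimage, Set.mem_Iic]
      constructor <;> intro h <;> linarith
    rw [hset] at h
    rw [← h]
    refine setIntegral_congr_fun measurableSet_Iic fun z hz => ?_
    have h0 : -σ ^ 2 / 2 + σ * z ≤ 0 := by
      have : z ≤ σ / 2 := hz
      nlinarith
    simp only [min_eq_right (Real.exp_le_one_iff.2 h0)]
    rw [← Real.exp_add]
    ring_nf
  rw [hleft, hright, stdNormalCDF]
  ring

/-- The joint law of the current position and the proposal in dimension `d`, arranged
coordinatewise. -/
noncomputable def jointMeasure (g : ℝ → ℝ) (h : ℝ) (d : ℕ) : Measure (Fin d → ℝ × ℝ) :=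
  volume.withDensity fun w => ENNReal.ofReal (∏ i, pairDensity g h (w i))

/-- The law of the log acceptance ratio in dimension `d`. -/
noncomputable def logRatioLaw (g : ℝ → ℝ) (h : ℝ) (d : ℕ) : Measure ℝ :=
  (jointMeasure g h d).map fun w => ∑ i, pairLogRatio g h (w i)

lemma measurable_prod_pairDensity (hg : AssumptionG g) (hε : 0 < ε) (d : ℕ) :
    Measurable fun w : Fin d → ℝ × ℝ => ∏ i, pairDensity g (ε ^ 2) (w i) := by
  have hd := measurable_pairDensity hg hε
  fun_prop

lemma measurable_sum_pairLogRatio (hg : AssumptionG g) (hε : 0 < ε) (d : ℕ) :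
    Measurable fun w : Fin d → ℝ × ℝ => ∑ i, pairLogRatio g (ε ^ 2) (w i) := by
  have hR := measurable_pairLogRatio hg hε
  fun_prop

lemma prod_pairDensity_pos (hg : AssumptionG g) (hε : 0 < ε)
    (hs : ∀ t, 0 < 1 + ε ^ 2 / 12 * iteratedDeriv 2 g t) {d : ℕ} (w : Fin d → ℝ × ℝ) :
    0 < ∏ i, pairDensity g (ε ^ 2) (w i) :=
  Finset.prod_pos fun _ _ => pairDensity_pos hg hε hs _

lemma integrable_pairDensity (hg : AssumptionG g) (hε : 0 < ε)
    (hs : ∀ t, 0 < 1 + ε ^ 2 / 12 * iteratedDeriv 2 g t) :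
    Integrable (pairDensity g (ε ^ 2)) := by
  have := isProbabilityMeasure_pairMeasure hg hε hs
  have h := (integrable_withDensity_ofReal_iff (measurable_pairDensity hg hε)
    (fun w => (pairDensity_pos hg hε hs w).le)).1
    (integrable_const (μ := pairMeasure g (ε ^ 2)) (1 : ℝ))
  simpa using h

lemma integral_pairDensity (hg : AssumptionG g) (hε : 0 < ε)
    (hs : ∀ t, 0 < 1 + ε ^ 2 / 12 * iteratedDeriv 2 g t) :
    ∫ w, pairDensity g (ε ^ 2) w = 1 := by
  have := isProbabilityMeasure_pairMeasure hg hε hs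
  have h := integral_withDensity_ofReal (μ := volume) (measurable_pairDensity hg hε)
    (fun w => (pairDensity_pos hg hε hs w).le) (fun _ => (1 : ℝ))
  simp only [smul_eq_mul, mul_one] at h
  rw [← h, ← pairMeasure]
  simp

lemma integrable_prod_pairDensity (hg : AssumptionG g) (hε : 0 < ε)
    (hs : ∀ t, 0 < 1 + ε ^ 2 / 12 * iteratedDeriv 2 g t) (d : ℕ) :
    Integrable fun w : Fin d → ℝ × ℝ => ∏ i, pairDensity g (ε ^ 2) (w i) :=
  Integrable.fintype_prod (f := fun _ => pairDensity g (ε ^ 2))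
    fun _ => integrable_pairDensity hg hε hs

lemma isProbabilityMeasure_logRatioLaw (hg : AssumptionG g) (hε : 0 < ε)
    (hs : ∀ t, 0 < 1 + ε ^ 2 / 12 * iteratedDeriv 2 g t) (d : ℕ) :
    IsProbabilityMeasure (logRatioLaw g (ε ^ 2) d) := by
  have : IsProbabilityMeasure (jointMeasure g (ε ^ 2) d) := by
    refine isProbabilityMeasure_withDensity_ofReal (integrable_prod_pairDensity hg hε hs d)
      (fun w => (prod_pairDensity_pos hg hε hs w).le) ?_
    rw [integral_fintype_prod_volume_eq_pow (pairDensity g (ε ^ 2)),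
      integral_pairDensity hg hε hs, one_pow]
  exact Measure.isProbabilityMeasure_map (measurable_sum_pairLogRatio hg hε d).aemeasurable

lemma charFun_logRatioLaw (hg : AssumptionG g) (hε : 0 < ε)
    (hs : ∀ t, 0 < 1 + ε ^ 2 / 12 * iteratedDeriv 2 g t) (d : ℕ) (t : ℝ) :
    charFun (logRatioLaw g (ε ^ 2) d) t
      = (∫ w, Complex.exp (t * Complex.I * pairLogRatio g (ε ^ 2) w)
        ∂(pairMeasure g (ε ^ 2))) ^ d := by
  rw [charFun_apply_real, logRatioLaw,
    integral_map (measurable_sum_pairLogRatio hg hε d).aemeasurable (by fun_prop), jointMeasure,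
    integral_withDensity_ofReal (measurable_prod_pairDensity hg hε d)
      (fun w => (prod_pairDensity_pos hg hε hs w).le), pairMeasure,
    integral_withDensity_ofReal (measurable_pairDensity hg hε)
      (fun w => (pairDensity_pos hg hε hs w).le)]
  conv_rhs => rw [← Fintype.card_fin d]
  rw [← integral_fintype_prod_volume_eq_pow]
  refine integral_congr_ae (ae_of_all _ fun w => ?_)
  simp only [Complex.real_smul]
  rw [Finset.prod_mul_distrib, ← Complex.exp_sum]
  push_cast
  congr 2
  rw [Finset.mul_sum, Finset.sum_mul]
  exact Finset.sum_congr rfl fun i _ => by ring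

lemma prodTarget_mul_fmalaDensity (g : ℝ → ℝ) (h : ℝ) (d : ℕ) (x y : Fin d → ℝ) :
    prodTarget g d x * fmalaDensity g h d x y = ∏ i, pairDensity g h (x i, y i) := by
  simp only [prodTarget, fmalaDensity, pairDensity, targetPDF, Finset.prod_mul_distrib,
    Finset.prod_div_distrib, Finset.prod_const, Finset.card_univ, Fintype.card_fin]

/-- The mean acceptance rate is the mean of `min 1 (exp S)` under the law of the log acceptance
ratio. -/
lemma integral_acceptance_eq (hg : AssumptionG g) (hε : 0 < ε)
    (hs : ∀ t, 0 < 1 + ε ^ 2 / 12 * iteratedDeriv 2 g t) (d : ℕ) :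
    ∫ x : Fin d → ℝ, ∫ y : Fin d → ℝ, prodTarget g d x * fmalaDensity g (ε ^ 2) d x y *
      min 1 (prodTarget g d y * fmalaDensity g (ε ^ 2) d y x /
        (prodTarget g d x * fmalaDensity g (ε ^ 2) d x y))
      = ∫ s, min 1 (Real.exp s) ∂(logRatioLaw g (ε ^ 2) d) := by
  have hS := measurable_sum_pairLogRatio hg hε d
  have hD := measurable_prod_pairDensity hg hε d
  have hD0 := prod_pairDensity_pos hg hε hs (d := d)
  have hpres := volume_measurePreserving_arrowProdEquivProdArrow ℝ ℝ (Fin d)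
  set F : (Fin d → ℝ) × (Fin d → ℝ) → ℝ := fun p =>
    prodTarget g d p.1 * fmalaDensity g (ε ^ 2) d p.1 p.2 *
      min 1 (prodTarget g d p.2 * fmalaDensity g (ε ^ 2) d p.2 p.1 /
        (prodTarget g d p.1 * fmalaDensity g (ε ^ 2) d p.1 p.2)) with hF
  have hcomp (w : Fin d → ℝ × ℝ) : F (MeasurableEquiv.arrowProdEquivProdArrow ℝ ℝ (Fin d) w)
      = (∏ i, pairDensity g (ε ^ 2) (w i))
        * min 1 (Real.exp (∑ i, pairLogRatio g (ε ^ 2) (w i))) := by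
    have h1 : (MeasurableEquiv.arrowProdEquivProdArrow ℝ ℝ (Fin d) w)
        = (fun i => (w i).1, fun i => (w i).2) := rfl
    have h2 : ∏ i, pairDensity g (ε ^ 2) ((w i).2, (w i).1)
        = (∏ i, pairDensity g (ε ^ 2) (w i))
          * Real.exp (∑ i, pairLogRatio g (ε ^ 2) (w i)) := by
      rw [Real.exp_sum, ← Finset.prod_mul_distrib]
      exact Finset.prod_congr rfl fun i _ => pairDensity_swap hg hε hs (w i)
    simp only [hF, h1, prodTarget_mul_fmalaDensity, h2, Prod.mk.eta]
    rw [mul_div_cancel_left₀ _ (hD0 w).ne']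
  have hInt : Integrable F := by
    rw [← hpres.integrable_comp_emb (MeasurableEquiv.measurableEmbedding _)]
    refine (integrable_prod_pairDensity hg hε hs d).mono' ?_ (ae_of_all _ fun w => ?_)
    · simp only [Function.comp_def, hcomp]
      fun_prop
    · rw [Function.comp_apply, hcomp, Real.norm_of_nonneg (by have := hD0 w; positivity)]
      exact mul_le_of_le_one_right (hD0 w).le (min_le_left _ _)
  rw [logRatioLaw, integral_map hS.aemeasurable (by fun_prop), jointMeasure,
    integral_withDensity_ofReal hD (fun w => (hD0 w).le)]
  calc _ = ∫ p, F p := by rw [Measure.volume_eq_prod, integral_prod _ hInt]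
    _ = _ := by
      rw [← hpres.integral_comp (MeasurableEquiv.measurableEmbedding _)]
      simp only [hcomp, smul_eq_mul]

/-- Weak limit of the mean acceptance rate along small steps `ε²` with `d ε¹⁰ → L`. -/
lemma tendsto_integral_logRatioLaw (hg : AssumptionG g) {e : ℕ → ℝ} {L σ : ℝ} (hσ : 0 ≤ σ)
    (hσL : σ ^ 2 = L * ∫ w, leadCoeff g w ^ 2 ∂(noiseMeasure g)) (he : ∀ d, 0 < e d)
    (hs : ∀ d t, 0 < 1 + e d ^ 2 / 12 * iteratedDeriv 2 g t)
    (he0 : Tendsto e atTop (nhds 0))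
    (heL : Tendsto (fun d : ℕ => (d : ℝ) * e d ^ 10) atTop (nhds L)) :
    Tendsto (fun d : ℕ => ∫ s, min 1 (Real.exp s) ∂(logRatioLaw g (e d ^ 2) d)) atTop
      (nhds (2 * stdNormalCDF (-σ / 2))) := by
  have hprob (d : ℕ) := isProbabilityMeasure_logRatioLaw hg (he d) (hs d) d
  have he0' : Tendsto e atTop (nhdsWithin 0 (Set.Ioi 0)) :=
    tendsto_nhdsWithin_iff.2 ⟨he0, Eventually.of_forall he⟩
  have hchar (t : ℝ) : Tendsto (fun d => charFun (logRatioLaw g (e d ^ 2) d) t) atTop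
      (nhds (charFun (gaussianReal (-σ ^ 2 / 2) (NNReal.mk (σ ^ 2) (sq_nonneg σ))) t)) := by
    have hfold (d : ℕ) : ∫ w, foldedChar t (pairLogRatio g (e d ^ 2) w)
          ∂(pairMeasure g (e d ^ 2))
        = (e d ^ 10 : ℝ) •
          ∫ w, ((e d ^ 10)⁻¹ : ℝ) • foldedChar t (logRatio g (e d) w) ∂(noiseMeasure g) := by
      have hmt := measurable_moveTarget hg (e d)
      have hmR := (measurable_foldedChar t).comp (measurable_pairLogRatio hg (he d))
      rw [pairMeasure_eq_map hg (he d) (hs d),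
        integral_map (f := fun w => foldedChar t (pairLogRatio g (e d ^ 2) w)) (by fun_prop)
          hmR.aestronglyMeasurable, integral_smul, smul_inv_smul₀ (pow_ne_zero _ (he d).ne')]
      simp only [pairLogRatio_moveTarget hg (he d) (hs d)]
    simp only [charFun_logRatioLaw hg (he _) (hs _), integral_exp_pairLogRatio hg (he _) (hs _),
      hfold, charFun_gaussianReal]
    refine Complex.tendsto_one_add_pow_exp_of_tendsto ?_
    have hlim := ((Complex.continuous_ofReal.tendsto L).comp heL).mul
      ((tendsto_integral_foldedChar hg t).comp he0')
    refine (hlim.congr fun d => ?_).trans_eq ?_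
    · simp only [Function.comp_apply, Complex.real_smul]
      push_cast
      ring
    · congr 1
      have hc : ((σ ^ 2 : ℝ) : ℂ) = L * (∫ w, leadCoeff g w ^ 2 ∂(noiseMeasure g) : ℝ) := by
        rw [hσL]
        push_cast
        rfl
      have hI := Complex.I_sq
      simp only [NNReal.coe_mk]
      push_cast at hc ⊢
      linear_combination ((t * Complex.I + t ^ 2) / 2) * hc
        + (L * (∫ w, leadCoeff g w ^ 2 ∂(noiseMeasure g) : ℝ) * t ^ 2 / 2) * hI
  have hweak := ProbabilityMeasure.tendsto_of_tendsto_charFun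
    (μ := fun d => ⟨logRatioLaw g (e d ^ 2) d, hprob d⟩)
    (μ₀ := ⟨gaussianReal (-σ ^ 2 / 2) (NNReal.mk (σ ^ 2) (sq_nonneg σ)), inferInstance⟩) hchar
  have htest := ProbabilityMeasure.tendsto_iff_forall_integral_tendsto.1 hweak
    (BoundedContinuousFunction.ofNormedAddCommGroup (fun s : ℝ => min 1 (Real.exp s))
      (by fun_prop) 1 fun s => by
      rw [Real.norm_of_nonneg (by positivity)]
      exact min_le_left _ _)
  rw [← integral_min_one_exp_gaussianReal hσ]
  exact htest

end Limit

end FMALA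

theorem fmala_acceptance_limit (g : ℝ → ℝ) (hg : AssumptionG g) (ℓ : ℝ) (hℓ : 0 < ℓ)
    (K : ℝ)
    (hK : K = Real.sqrt
      ((∫ t : ℝ, kappaFun g t * Real.exp (g t)) / ∫ t : ℝ, Real.exp (g t))) :
    Tendsto (fun d : ℕ => meanAcceptRate g ℓ d) atTop
      (nhds (2 * stdNormalCDF (-(K * ℓ ^ 5) / 2))) := by
  obtain ⟨e₀, M, h0, -, hM, heM⟩ := FMALA.exists_small_step hg
  set e : ℕ → ℝ := fun d => ℓ * (d : ℝ) ^ (-(1 : ℝ) / 10) with he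
  have hpow (d : ℕ) : ℓ ^ 2 * (d : ℝ) ^ (-(1 : ℝ) / 5) = e d ^ 2 := by
    rw [he, mul_pow, ← Real.rpow_natCast ((d : ℝ) ^ _), ← Real.rpow_mul (Nat.cast_nonneg d)]
    norm_num
  have he0 : Tendsto e atTop (nhds 0) := by
    have h := ((tendsto_rpow_neg_atTop (y := 1 / 10) (by norm_num)).comp
      tendsto_natCast_atTop_atTop).const_mul ℓ
    rw [mul_zero] at h
    refine h.congr fun d => ?_
    simp only [Function.comp_apply, he]
    norm_num
  have hpos : ∀ᶠ d in atTop, 0 < e d := by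
    filter_upwards [eventually_gt_atTop 0] with d hd
    have : (0 : ℝ) < d := Nat.cast_pos.2 hd
    positivity
  set e' : ℕ → ℝ := fun d => if 0 < e d ∧ e d ≤ e₀ then e d else e₀ with he'
  have hee' : ∀ᶠ d in atTop, e d = e' d := by
    filter_upwards [hpos, he0.eventually (eventually_le_nhds h0)] with d h1 h2
    exact (if_pos ⟨h1, h2⟩).symm
  have hpos' (d : ℕ) : 0 < e' d := by
    simp only [he']
    split_ifs with h
    exacts [h.1, h0]
  have hle' (d : ℕ) : e' d ≤ e₀ := by
    simp only [he']
    split_ifs with h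
    exacts [h.2, le_rfl]
  have hs (d : ℕ) := FMALA.one_add_pos_of_le hM heM (hpos' d) (hle' d)
  have hκ := FMALA.integral_leadCoeff_sq hg
  have hκ0 : 0 ≤ ∫ w, FMALA.leadCoeff g w ^ 2 ∂(FMALA.noiseMeasure g) :=
    integral_nonneg fun w => sq_nonneg _
  rw [← hκ] at hK
  have hlim : Tendsto (fun d : ℕ => (d : ℝ) * e' d ^ 10) atTop (nhds (ℓ ^ 10)) := by
    refine tendsto_const_nhds.congr' ?_
    filter_upwards [hee', eventually_gt_atTop 0] with d h1 hd
    have hd' : (0 : ℝ) < d := Nat.cast_pos.2 hd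
    rw [← h1, he, mul_pow, ← Real.rpow_natCast ((d : ℝ) ^ _), ← Real.rpow_mul hd'.le]
    norm_num [Real.rpow_neg_one]
    field_simp
  have hσ : (K * ℓ ^ 5) ^ 2 = ℓ ^ 10 * ∫ w, FMALA.leadCoeff g w ^ 2 ∂(FMALA.noiseMeasure g) := by
    rw [mul_pow, hK, Real.sq_sqrt hκ0]
    ring
  refine (FMALA.tendsto_integral_logRatioLaw hg (by rw [hK]; positivity) hσ hpos' hs
    (he0.congr' hee') hlim).congr' ?_
  filter_upwards [hee'] with d hd
  rw [meanAcceptRate, hpow, hd, FMALA.integral_acceptance_eq hg (hpos' d) (hs d)]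
end

section
/- For every K > 0, the function h_K(ℓ) = 2 ℓ² Φ(−K ℓ⁵/2) on (0,∞) attains its supremum at a unique point ℓ*(K); moreover, the corresponding acceptance value a_K(ℓ*(K)) = 2Φ(−K ℓ*(K)⁵/2) is the same for every K > 0 (it equals the value obtained for K = 1). -/
open Filter

/-- The limiting diffusion speed `h_K(ℓ) = 2 ℓ² Φ(−K ℓ⁵/2)` of fMALA. -/
noncomputable def diffusionSpeed (K ℓ : ℝ) : ℝ :=
  2 * ℓ ^ 2 * stdNormalCDF (-(K * ℓ ^ 5) / 2)

/-- The limiting mean acceptance rate `a_K(ℓ) = 2 Φ(−K ℓ⁵/2)`. -/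
noncomputable def acceptRate (K ℓ : ℝ) : ℝ :=
  2 * stdNormalCDF (-(K * ℓ ^ 5) / 2)

/-- The standard normal density. -/
noncomputable def stdNormalPDF (t : ℝ) : ℝ :=
  (Real.sqrt (2 * Real.pi))⁻¹ * Real.exp (-t ^ 2 / 2)

theorem stdNormalPDF_pos (t : ℝ) : 0 < stdNormalPDF t := by
  unfold stdNormalPDF
  positivity

theorem stdNormalPDF_neg (t : ℝ) : stdNormalPDF (-t) = stdNormalPDF t := by
  simp [stdNormalPDF]

theorem hasDerivAt_exp_neg_sq_div_two (t : ℝ) :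
    HasDerivAt (fun s : ℝ => Real.exp (-s ^ 2 / 2)) (-t * Real.exp (-t ^ 2 / 2)) t := by
  have h : HasDerivAt (fun s : ℝ => -s ^ 2 / 2) (-t) t := by
    refine (((hasDerivAt_id t).pow 2).neg.div_const 2).congr_deriv ?_
    simp only [id]
    ring
  exact h.exp.congr_deriv (mul_comm _ _)

theorem hasDerivAt_stdNormalPDF (t : ℝ) :
    HasDerivAt stdNormalPDF (-t * stdNormalPDF t) t := by
  refine ((hasDerivAt_exp_neg_sq_div_two t).const_mul _).congr_deriv ?_
  unfold stdNormalPDF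
  ring

theorem integrable_exp_neg_sq_div_two :
    MeasureTheory.Integrable (fun s : ℝ => Real.exp (-s ^ 2 / 2)) := by
  refine (integrable_exp_neg_mul_sq (b := 1 / 2) (by norm_num)).congr (.of_forall fun s => ?_)
  simp only
  congr 1
  ring

theorem integrable_neg_mul_exp_neg_sq_div_two :
    MeasureTheory.Integrable (fun s : ℝ => -s * Real.exp (-s ^ 2 / 2)) := by
  refine (integrable_mul_exp_neg_mul_sq (b := 1 / 2) (by norm_num)).neg.congr
    (.of_forall fun s => ?_)
  simp only [Pi.neg_apply, neg_mul]
  congr 3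
  ring

theorem hasDerivAt_stdNormalCDF (t : ℝ) :
    HasDerivAt stdNormalCDF (stdNormalPDF t) t := by
  have hcont : Continuous fun s : ℝ => Real.exp (-s ^ 2 / 2) := by fun_prop
  have hsplit : (fun u : ℝ => ∫ s in Set.Iic u, Real.exp (-s ^ 2 / 2)) =
      fun u => (∫ s in Set.Iic (0 : ℝ), Real.exp (-s ^ 2 / 2)) +
        ∫ s in (0 : ℝ)..u, Real.exp (-s ^ 2 / 2) := by
    funext u
    rw [← intervalIntegral.integral_Iic_sub_Iic integrable_exp_neg_sq_div_two.integrableOn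
      integrable_exp_neg_sq_div_two.integrableOn]
    ring
  have h : HasDerivAt (fun u : ℝ => ∫ s in Set.Iic u, Real.exp (-s ^ 2 / 2))
      (Real.exp (-t ^ 2 / 2)) t := by
    rw [hsplit]
    exact (hcont.integral_hasStrictDerivAt 0 t).hasDerivAt.const_add _
  exact h.const_mul _

theorem stdNormalCDF_pos (t : ℝ) : 0 < stdNormalCDF t := by
  refine mul_pos (by positivity) ?_
  rw [MeasureTheory.setIntegral_pos_iff_support_of_nonneg_ae
    (.of_forall fun s => (Real.exp_pos _).le) integrable_exp_neg_sq_div_two.integrableOn]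
  have : Function.support (fun s : ℝ => Real.exp (-s ^ 2 / 2)) = Set.univ :=
    Set.eq_univ_of_forall fun s => (Real.exp_pos _).ne'
  simp [this]

/-- The Mills ratio bound for the lower tail of the standard normal law. -/
theorem neg_mul_stdNormalCDF_le (t : ℝ) : -t * stdNormalCDF t ≤ stdNormalPDF t := by
  have hlim : Tendsto (fun s : ℝ => Real.exp (-s ^ 2 / 2)) atBot (nhds 0) := by
    refine Real.tendsto_exp_atBot.comp ?_
    have h : Tendsto (fun s : ℝ => (-s) ^ 2) atBot atTop :=
      (tendsto_pow_atTop (α := ℝ) two_ne_zero).comp tendsto_neg_atBot_atTop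
    simp only [neg_sq] at h
    exact (tendsto_neg_atTop_atBot.comp h).atBot_div_const two_pos
  have hint : ∫ s in Set.Iic t, -s * Real.exp (-s ^ 2 / 2) = Real.exp (-t ^ 2 / 2) := by
    rw [MeasureTheory.integral_Iic_of_hasDerivAt_of_tendsto'
      (fun s _ => hasDerivAt_exp_neg_sq_div_two s)
      integrable_neg_mul_exp_neg_sq_div_two.integrableOn hlim, sub_zero]
  have hle : -t * ∫ s in Set.Iic t, Real.exp (-s ^ 2 / 2) ≤ Real.exp (-t ^ 2 / 2) := by
    rw [← hint, ← MeasureTheory.integral_const_mul]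
    refine MeasureTheory.setIntegral_mono_on
      (integrable_exp_neg_sq_div_two.const_mul _).integrableOn
      integrable_neg_mul_exp_neg_sq_div_two.integrableOn measurableSet_Iic fun s hs => ?_
    exact mul_le_mul_of_nonneg_right (neg_le_neg hs) (Real.exp_pos _).le
  have := mul_le_mul_of_nonneg_left hle (inv_nonneg.mpr (Real.sqrt_nonneg (2 * Real.pi)))
  unfold stdNormalCDF stdNormalPDF
  linarith

/-- With `x = K ℓ⁵ / 2`, the derivative of `diffusionSpeed K` at `ℓ` is `2 ℓ * speedSlope x`. -/
noncomputable def speedSlope (x : ℝ) : ℝ :=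
  2 * stdNormalCDF (-x) - 5 * x * stdNormalPDF x

theorem hasDerivAt_speedSlope (x : ℝ) :
    HasDerivAt speedSlope ((5 * x ^ 2 - 7) * stdNormalPDF x) x := by
  have h₁ : HasDerivAt (fun y : ℝ => stdNormalCDF (-y)) (stdNormalPDF (-x) * -1) x :=
    (hasDerivAt_stdNormalCDF (-x)).comp x (hasDerivAt_neg x)
  refine ((h₁.const_mul 2).sub
    (((hasDerivAt_id x).const_mul 5).mul (hasDerivAt_stdNormalPDF x))).congr_deriv ?_
  rw [stdNormalPDF_neg]
  simp only [id]
  ring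

theorem speedSlope_neg_of_one_le {x : ℝ} (hx : 1 ≤ x) : speedSlope x < 0 := by
  have h := neg_mul_stdNormalCDF_le (-x)
  rw [stdNormalPDF_neg, neg_neg] at h
  have hΦ := stdNormalCDF_pos (-x)
  have hφ := stdNormalPDF_pos x
  unfold speedSlope
  nlinarith [mul_nonneg (sub_nonneg.mpr hx) hΦ.le, mul_nonneg (sub_nonneg.mpr hx) hφ.le]

theorem strictAntiOn_speedSlope : StrictAntiOn speedSlope (Set.Icc 0 1) := by
  refine strictAntiOn_of_deriv_neg (convex_Icc 0 1)
    (fun x _ => (hasDerivAt_speedSlope x).continuousAt.continuousWithinAt) fun x hx => ?_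
  rw [interior_Icc] at hx
  rw [(hasDerivAt_speedSlope x).deriv]
  exact mul_neg_of_neg_of_pos (by nlinarith [hx.1, hx.2]) (stdNormalPDF_pos x)

/-- The function `speedSlope` changes sign exactly once on the positive half-line. -/
theorem exists_speedSlope_sign_change :
    ∃ x₀ : ℝ, 0 < x₀ ∧ (∀ x, 0 < x → x < x₀ → 0 < speedSlope x) ∧
      ∀ x, x₀ < x → speedSlope x < 0 := by
  have hzero : 0 < speedSlope 0 := by
    have := stdNormalCDF_pos 0
    simp [speedSlope, this]
  obtain ⟨x₀, hx₀, hroot⟩ := intermediate_value_Icc' zero_le_one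
    (fun x _ => (hasDerivAt_speedSlope x).continuousAt.continuousWithinAt)
    ⟨(speedSlope_neg_of_one_le le_rfl).le, hzero.le⟩
  refine ⟨x₀, hx₀.1.lt_of_ne fun h => ?_, fun x hx hlt => ?_, fun x hlt => ?_⟩
  · rw [← h] at hroot
    exact hzero.ne' hroot
  · rw [← hroot]
    exact strictAntiOn_speedSlope ⟨hx.le, hlt.le.trans hx₀.2⟩ hx₀ hlt
  · rcases le_total x 1 with hx | hx
    · rw [← hroot]
      exact strictAntiOn_speedSlope hx₀ ⟨hx₀.1.trans hlt.le, hx⟩ hlt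
    · exact speedSlope_neg_of_one_le hx

theorem hasDerivAt_diffusionSpeed (K l : ℝ) :
    HasDerivAt (diffusionSpeed K) (2 * l * speedSlope (K * l ^ 5 / 2)) l := by
  have harg : HasDerivAt (fun m : ℝ => -(K * m ^ 5) / 2) (-(K * (5 * l ^ 4)) / 2) l := by
    simpa using (((hasDerivAt_pow 5 l).const_mul K).neg.div_const 2)
  have hΦ : HasDerivAt (fun m : ℝ => stdNormalCDF (-(K * m ^ 5) / 2))
      (stdNormalPDF (-(K * l ^ 5) / 2) * (-(K * (5 * l ^ 4)) / 2)) l :=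
    HasDerivAt.comp (h₂ := stdNormalCDF) l (hasDerivAt_stdNormalCDF _) harg
  refine (((hasDerivAt_pow 2 l).const_mul 2).mul hΦ).congr_deriv ?_
  rw [speedSlope, neg_div, stdNormalPDF_neg]
  push_cast
  ring

theorem exists_pos_mul_pow_five_div_two_eq {K x : ℝ} (hK : 0 < K) (hx : 0 < x) :
    ∃ r : ℝ, 0 < r ∧ K * r ^ 5 / 2 = x := by
  refine ⟨(2 * x / K) ^ ((5 : ℕ) : ℝ)⁻¹, by positivity, ?_⟩
  rw [Real.rpow_inv_natCast_pow (by positivity) (by norm_num)]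
  field_simp

/-- The maximisers of the diffusion speed are characterised by a value of `K ℓ⁵ / 2` which does
not depend on `K`. -/
theorem exists_maximiser_iff :
    ∃ x₀ : ℝ, 0 < x₀ ∧ ∀ K l : ℝ, 0 < K → 0 < l →
      ((∀ m : ℝ, 0 < m → diffusionSpeed K m ≤ diffusionSpeed K l) ↔ K * l ^ 5 / 2 = x₀) := by
  obtain ⟨x₀, hx₀, hpos, hneg⟩ := exists_speedSlope_sign_change
  have hlt : ∀ K l m : ℝ, 0 < K → 0 < l → 0 < m → K * l ^ 5 / 2 = x₀ → m ≠ l →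
      diffusionSpeed K m < diffusionSpeed K l := by
    intro K l m hK hl hm hx hne
    rcases hne.lt_or_gt with h | h
    · refine strictMonoOn_of_deriv_pos (convex_Icc 0 l)
        (fun y _ => (hasDerivAt_diffusionSpeed K y).continuousAt.continuousWithinAt)
        (fun y hy => ?_) ⟨hm.le, h.le⟩ ⟨hl.le, le_rfl⟩ h
      rw [interior_Icc] at hy
      obtain ⟨hy₀, hyl⟩ := hy
      rw [(hasDerivAt_diffusionSpeed K y).deriv]
      refine mul_pos (by positivity) (hpos _ (by positivity) ?_)
      rw [← hx]
      gcongr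
    · refine strictAntiOn_of_deriv_neg (convex_Ici l)
        (fun y _ => (hasDerivAt_diffusionSpeed K y).continuousAt.continuousWithinAt)
        (fun y hy => ?_) Set.self_mem_Ici h.le h
      rw [interior_Ici] at hy
      have hly : l < y := hy
      rw [(hasDerivAt_diffusionSpeed K y).deriv]
      refine mul_neg_of_pos_of_neg (by linarith) (hneg _ ?_)
      rw [← hx]
      gcongr
  refine ⟨x₀, hx₀, fun K l hK hl => ⟨fun hmax => ?_, fun hx m hm => ?_⟩⟩
  · obtain ⟨r, hr, hr₀⟩ := exists_pos_mul_pow_five_div_two_eq hK hx₀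
    by_contra hx
    refine (hlt K r l hK hr hl hr₀ ?_).not_ge (hmax r hr)
    rintro rfl
    exact hx hr₀
  · rcases eq_or_ne m l with rfl | hne
    · exact le_rfl
    · exact (hlt K l m hK hl hm hx hne).le

theorem fmala_optimal_acceptance :
    (∀ K : ℝ, 0 < K →
      ∃! l : ℝ, 0 < l ∧ ∀ l' : ℝ, 0 < l' → diffusionSpeed K l' ≤ diffusionSpeed K l) ∧
    (∀ K K' : ℝ, 0 < K → 0 < K' → ∀ l l' : ℝ,
      (0 < l ∧ ∀ m : ℝ, 0 < m → diffusionSpeed K m ≤ diffusionSpeed K l) →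
      (0 < l' ∧ ∀ m : ℝ, 0 < m → diffusionSpeed K' m ≤ diffusionSpeed K' l') →
      acceptRate K l = acceptRate K' l') := by
  obtain ⟨x₀, hx₀, hiff⟩ := exists_maximiser_iff
  refine ⟨fun K hK => ?_, fun K K' hK hK' l l' ⟨hl, hmax⟩ ⟨hl', hmax'⟩ => ?_⟩
  · obtain ⟨r, hr, hr₀⟩ := exists_pos_mul_pow_five_div_two_eq hK hx₀
    refine ⟨r, ⟨hr, (hiff K r hK hr).mpr hr₀⟩, fun l ⟨hl, hmax⟩ => ?_⟩
    have hl₀ := (hiff K l hK hl).mp hmax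
    refine (pow_left_inj₀ hl.le hr.le (n := 5) (by norm_num)).mp (mul_left_cancel₀ hK.ne' ?_)
    linarith
  · rw [acceptRate, acceptRate, neg_div, neg_div, (hiff K l hK hl).mp hmax,
      (hiff K' l' hK' hl').mp hmax']
end

section
/- For every real m ≥ 3, Ψ(m) > 0, where Ψ(m) = 1 − (1 − 5/(3(m−1)))^m − (3/8) m (m−1) [1 − (1 − 5/(3(m−1)))²]² (1 − 5/(3(m−1)))^{m−2}. (Note that 1 − 5/(3(m−1)) ∈ (0,1) for m ≥ 3, so the real powers are well defined.) -/
/-- The function `Ψ` arising in the verification that the bOMA acceptance probability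
does not degenerate at infinity for targets in `𝒫ₘ⁺`, `m ≥ 3`; real-exponent powers are
`Real.rpow`. -/
noncomputable def PsiBoma (m : ℝ) : ℝ :=
  1 - (1 - 5 / (3 * (m - 1))) ^ m -
    (3 / 8) * m * (m - 1) * (1 - (1 - 5 / (3 * (m - 1))) ^ (2 : ℕ)) ^ (2 : ℕ) *
      (1 - 5 / (3 * (m - 1))) ^ (m - 2)

theorem Real.log_one_sub_le_neg_sub_sq_div_two {u : ℝ} (h0 : 0 ≤ u) (h1 : u < 1) :
    Real.log (1 - u) ≤ -u - u ^ 2 / 2 := by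
  have h := Real.hasSum_pow_div_log_of_abs_lt_one (abs_lt.mpr ⟨by linarith, h1⟩)
  have hs := sum_le_hasSum (Finset.range 2) (fun i _ => by positivity) h
  norm_num [Finset.sum_range_succ] at hs
  linarith

theorem Real.lt_exp_five_thirds : 5.2 < Real.exp (5 / 3) := by
  have h1 := Real.exp_one_gt_d9
  have h2 := Real.sum_le_exp_of_nonneg (show (0 : ℝ) ≤ 2 / 3 by norm_num) 4
  norm_num [Finset.sum_range_succ, Nat.factorial] at h2
  rw [show (5 / 3 : ℝ) = 1 + 2 / 3 by norm_num, Real.exp_add]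
  nlinarith

/-- The polynomial factor multiplying `(1 - u) ^ (m - 2)` in `1 - Ψ(m)`, where
`u = 5 / (3 (m - 1))`. -/
theorem psiBoma_factor_lt_exp {u : ℝ} (h0 : 0 < u) (h1 : u ≤ 5 / 6) :
    (1 - u) ^ 2 + 3 / 8 * (25 / 9 + 5 / 3 * u) * (2 - u) ^ 2 <
      Real.exp ((5 / 3 - u) * (1 + u / 2)) := by
  rw [show (5 / 3 - u) * (1 + u / 2) = 5 / 3 + -(u / 6 + u ^ 2 / 2) by ring, Real.exp_add]
  have hlin := Real.add_one_le_exp (-(u / 6 + u ^ 2 / 2))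
  have hc := Real.lt_exp_five_thirds
  calc
    _ < 5.2 * (-(u / 6 + u ^ 2 / 2) + 1) := by
      have hsq : u ^ 2 ≤ 5 / 6 * u := by nlinarith
      have hcube : u ^ 3 ≤ 25 / 36 * u := by nlinarith
      norm_num
      nlinarith
    _ ≤ Real.exp (5 / 3) * Real.exp (-(u / 6 + u ^ 2 / 2)) := by
      refine mul_le_mul hc.le hlin ?_ (Real.exp_pos _).le
      nlinarith

theorem psi_boma_pos (m : ℝ) (hm : 3 ≤ m) : 0 < PsiBoma m := by
  unfold PsiBoma
  have hm1 : 0 < m - 1 := by linarith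
  set u := 5 / (3 * (m - 1)) with hu
  have hum : u * (m - 1) = 5 / 3 := by rw [hu]; field_simp
  have h0 : 0 < u := by positivity
  have h1 : u ≤ 5 / 6 := by nlinarith
  have ht : 0 < 1 - u := by linarith
  have hpow : (1 - u) ^ m = (1 - u) ^ (m - 2) * (1 - u) ^ 2 := by
    rw [← Real.rpow_natCast, ← Real.rpow_add ht]
    norm_num
  have hfactor : 3 / 8 * m * (m - 1) * (1 - (1 - u) ^ 2) ^ 2 =
      3 / 8 * (25 / 9 + 5 / 3 * u) * (2 - u) ^ 2 := by
    linear_combination (3 / 8) * (2 - u) ^ 2 * (u * (m - 1) + 5 / 3 + u) * hum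
  have hexp : (1 - u) ^ (m - 2) ≤ Real.exp (-((5 / 3 - u) * (1 + u / 2))) := by
    rw [Real.rpow_def_of_pos ht]
    apply Real.exp_le_exp.mpr
    have hlog := Real.log_one_sub_le_neg_sub_sq_div_two h0.le (by linarith)
    calc
      _ ≤ (-u - u ^ 2 / 2) * (m - 2) := mul_le_mul_of_nonneg_right hlog (by linarith)
      _ = _ := by linear_combination (-1 - u / 2) * hum
  have hlt := psiBoma_factor_lt_exp h0 h1
  rw [hpow, hfactor]
  have hprod : (1 - u) ^ (m - 2) *
      ((1 - u) ^ 2 + 3 / 8 * (25 / 9 + 5 / 3 * u) * (2 - u) ^ 2) < 1 := by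
    calc
      _ < (1 - u) ^ (m - 2) * Real.exp ((5 / 3 - u) * (1 + u / 2)) :=
        mul_lt_mul_of_pos_left hlt (Real.rpow_pos_of_pos ht _)
      _ ≤ Real.exp (-((5 / 3 - u) * (1 + u / 2))) * Real.exp ((5 / 3 - u) * (1 + u / 2)) :=
        mul_le_mul_of_nonneg_right hexp (Real.exp_pos _).le
      _ = 1 := by rw [← Real.exp_add, neg_add_cancel, Real.exp_zero]
  linarith
end

section
/- For all h > 0 and λ > 0, Ξ(h,λ) > 0, where Ξ(h,λ) = λ [ 1 − (ϱ(hλ) + 1)² + ς(hλ)^{-1} (4ϱ(hλ)² + 4ϱ(hλ)³ + ϱ(hλ)⁴) ], with ϱ(t) = (e^{-t} − 1) + (2/3)(e^{-t²} − 1) and ς(t) = (e^{-2t} − 1) + (1/3)(e^{-4t²} − 1). (For t > 0 one has ς(t) < 0, so Ξ(h,λ) is well defined.) -/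
/-- `ϱ(t) = (e^{-t} − 1) + (2/3)(e^{-t²} − 1)`. -/
noncomputable def rhoBoma (t : ℝ) : ℝ :=
  (Real.exp (-t) - 1) + (2 / 3) * (Real.exp (-t ^ 2) - 1)

/-- `ς(t) = (e^{-2t} − 1) + (1/3)(e^{-4t²} − 1)`. -/
noncomputable def sigBoma (t : ℝ) : ℝ :=
  (Real.exp (-(2 * t)) - 1) + (1 / 3) * (Real.exp (-(4 * t ^ 2)) - 1)

/-- The function `Ξ(h,λ)` from the Gaussian-target (`𝒫₂⁺`) case of the bOMA analysis. -/
noncomputable def XiBoma (h lam : ℝ) : ℝ :=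
  lam * (1 - (rhoBoma (h * lam) + 1) ^ 2 +
    (sigBoma (h * lam))⁻¹ *
      (4 * rhoBoma (h * lam) ^ 2 + 4 * rhoBoma (h * lam) ^ 3 + rhoBoma (h * lam) ^ 4))

lemma exp_neg_le_quadratic {t : ℝ} (ht : 0 ≤ t) : Real.exp (-t) ≤ 1 - t + t ^ 2 / 2 := by
  have h1 := Real.quadratic_le_exp_of_nonneg ht
  have hp : 0 < 1 - t + t ^ 2 / 2 := by nlinarith [sq_nonneg (t - 1)]
  rw [Real.exp_neg, inv_le_iff_one_le_mul₀ (Real.exp_pos t)]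
  calc (1 : ℝ) ≤ (1 - t + t ^ 2 / 2) * (1 + t + t ^ 2 / 2) := by nlinarith [sq_nonneg (t ^ 2)]
    _ ≤ (1 - t + t ^ 2 / 2) * Real.exp t := by gcongr

/-- The inequality equivalent to `-sigBoma t > -rhoBoma t * (2 + rhoBoma t)` after factoring out
`1 - exp (-t ^ 2)`. -/
lemma twelve_mul_exp_neg_lt {t : ℝ} (ht : 0 < t) :
    12 * Real.exp (-t) <
      7 - Real.exp (-t ^ 2) + 3 * Real.exp (-t ^ 2) ^ 2 + 3 * Real.exp (-t ^ 2) ^ 3 := by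
  have hb0 := Real.exp_pos (-t ^ 2)
  have hb : 1 - t ^ 2 ≤ Real.exp (-t ^ 2) := by linarith [Real.add_one_le_exp (-t ^ 2)]
  set b := Real.exp (-t ^ 2)
  rcases le_total t (3 / 5) with h | h
  · have ha := exp_neg_le_quadratic ht.le
    have hu : t ^ 2 ≤ 9 / 25 := by nlinarith
    have hmono : 7 - (1 - t ^ 2) + 3 * (1 - t ^ 2) ^ 2 + 3 * (1 - t ^ 2) ^ 3 ≤
        7 - b + 3 * b ^ 2 + 3 * b ^ 3 := by
      have hc : (16 / 25 : ℝ) ≤ 1 - t ^ 2 := by linarith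
      generalize 1 - t ^ 2 = c at hb hc ⊢
      have hk : 0 ≤ -1 + 3 * (b + c) + 3 * (b ^ 2 + b * c + c ^ 2) := by
        have : 0 ≤ b ^ 2 + b * c + c ^ 2 := by positivity
        linarith
      nlinarith [mul_nonneg (sub_nonneg.2 hb) hk]
    have hpos : 0 < t * (12 - 20 * t + t ^ 3 * (12 - 3 * t ^ 2)) := by
      have : 0 < t ^ 3 * (12 - 3 * t ^ 2) := mul_pos (by positivity) (by linarith)
      exact mul_pos ht (by linarith)
    nlinarith
  · have ha : Real.exp (-t) ≤ (89 / 50 : ℝ)⁻¹ := by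
      rw [Real.exp_neg]
      gcongr
      nlinarith [Real.quadratic_le_exp_of_nonneg ht.le]
    norm_num at ha
    have hb3 : 0 < b ^ 3 := by positivity
    nlinarith [sq_nonneg (b - 1 / 6)]

theorem xi_boma_pos (h lam : ℝ) (hh : 0 < h) (hlam : 0 < lam) : 0 < XiBoma h lam := by
  have ht : 0 < h * lam := mul_pos hh hlam
  unfold XiBoma
  generalize h * lam = t at ht ⊢
  have key := twelve_mul_exp_neg_lt ht
  have ha0 := Real.exp_pos (-t)
  have ha1 : Real.exp (-t) < 1 := Real.exp_lt_one_iff.2 (by linarith)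
  have hb0 := Real.exp_pos (-t ^ 2)
  have hb1 : Real.exp (-t ^ 2) < 1 := Real.exp_lt_one_iff.2 (neg_neg_of_pos (by positivity))
  have hsig : sigBoma t = Real.exp (-t) ^ 2 - 1 + 1 / 3 * (Real.exp (-t ^ 2) ^ 4 - 1) := by
    simp only [sigBoma, ← Real.exp_nat_mul]
    push_cast
    ring_nf
  have hrho : rhoBoma t = Real.exp (-t) - 1 + 2 / 3 * (Real.exp (-t ^ 2) - 1) := rfl
  generalize Real.exp (-t) = a at *
  generalize Real.exp (-t ^ 2) = b at *
  have hr0 : rhoBoma t < 0 := by rw [hrho]; linarith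
  have hr2 : 0 < 2 + rhoBoma t := by rw [hrho]; linarith
  have hgap : sigBoma t < rhoBoma t * (2 + rhoBoma t) := by
    rw [hrho, hsig]
    nlinarith [mul_pos (sub_pos.2 hb1) (sub_pos.2 key)]
  generalize rhoBoma t = r at *
  have hp : r * (2 + r) < 0 := mul_neg_of_neg_of_pos hr0 hr2
  have hs : sigBoma t < 0 := hgap.trans hp
  generalize sigBoma t = s at *
  have hfactor : 1 - (r + 1) ^ 2 + s⁻¹ * (4 * r ^ 2 + 4 * r ^ 3 + r ^ 4) =
      (r * (2 + r)) * (r * (2 + r) - s) / s := by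
    field_simp [hs.ne]
    ring
  rw [hfactor]
  exact mul_pos hlam (div_pos_of_neg_of_neg (mul_neg_of_neg_of_pos hp (sub_pos.2 hgap)) hs)
end

section
/- Let Q be the Markov kernel on ℝ with Q(x,·) = N(μ(x), S(x)²), where μ and S are continuous and S(x) > 0 for all x. Assume liminf_{|x|→∞} S(x) ≥ s for some s ∈ (0,∞), and that there exist χ ∈ ℝ and u₊, u₋ > 0 with lim_{x→+∞} S(x)^{-1} μ(x) x^{-χ} = −u₊ and lim_{x→−∞} S(x)^{-1} μ(x) |x|^{-χ} = u₋. Then: (1) if χ > 1, Q is transient; (2) if χ = 1 and min(u₊, u₋) · s > 1, Q is transient. -/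
open MeasureTheory ProbabilityTheory Filter
open scoped NNReal ENNReal Classical

/-- Iterates of a Markov kernel: `kiter Q n = Qⁿ`. -/
noncomputable def kiter {α : Type*} [MeasurableSpace α] (Q : Kernel α α) : ℕ → Kernel α α
  | 0 => Kernel.id
  | n + 1 => (kiter Q n).comp Q

/-- A Markov kernel `Q` is transient: the space is a countable union of uniformly
transient Borel sets. -/
def IsTransientKernel {α : Type*} [MeasurableSpace α] (Q : Kernel α α) : Prop :=
  ∃ A : ℕ → Set α, (∀ j, MeasurableSet (A j)) ∧ (⋃ j, A j) = Set.univ ∧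
    ∀ j, ∃ B : ℝ≥0∞, B < ⊤ ∧ ∀ x, (∑' n : ℕ, kiter Q n x (A j)) ≤ B

/-- The potential kernel of `A` is dominated by a Lyapunov function whose drift is bounded below
on `A`. -/
theorem mul_sum_kiter_le_of_drift {α : Type*} [MeasurableSpace α] (Q : Kernel α α)
    {W : α → ℝ≥0∞} {A : Set α} (hA : MeasurableSet A) {ε : ℝ≥0∞}
    (hdrift : ∀ x, A.indicator (fun _ => ε) x + ∫⁻ y, W y ∂(Q x) ≤ W x) (N : ℕ) :
    ∀ x, ε * ∑ n ∈ Finset.range N, kiter Q n x A ≤ W x := by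
  induction N with
  | zero => simp
  | succ N ih =>
    intro x
    have hmeas (n : ℕ) : Measurable fun y => kiter Q n y A := (kiter Q n).measurable_coe hA
    have hstep (n : ℕ) : kiter Q (n + 1) x A = ∫⁻ y, kiter Q n y A ∂(Q x) :=
      Kernel.comp_apply' _ _ _ hA
    have hzero : ε * kiter Q 0 x A = A.indicator (fun _ => ε) x := by
      by_cases hx : x ∈ A <;> simp [kiter, Kernel.id_apply, Measure.dirac_apply' _ hA, hx]
    rw [Finset.sum_range_succ', mul_add, hzero, add_comm]
    refine le_trans (add_le_add le_rfl ?_) (hdrift x)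
    simp only [hstep]
    rw [← lintegral_finsetSum _ fun n _ => hmeas n,
      ← lintegral_const_mul _ (Finset.measurable_fun_sum _ fun n _ => hmeas n)]
    exact lintegral_mono ih

/-- A kernel admitting a bounded strict supersolution is transient. -/
theorem isTransientKernel_of_lintegral_lt {α : Type*} [MeasurableSpace α] (Q : Kernel α α)
    {W : α → ℝ≥0∞} (hW : Measurable W) {M : ℝ≥0∞} (hM : M < ⊤) (hWM : ∀ x, W x ≤ M)
    (hlt : ∀ x, ∫⁻ y, W y ∂(Q x) < W x) : IsTransientKernel Q := by
  have hQW : Measurable fun x => ∫⁻ y, W y ∂(Q x) := hW.lintegral_kernel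
  have hmeas (j : ℕ) :
      MeasurableSet {x | ((j : ℝ≥0∞) + 1)⁻¹ + ∫⁻ y, W y ∂(Q x) ≤ W x} :=
    measurableSet_le (measurable_const.add hQW) hW
  refine ⟨fun j => {x | ((j : ℝ≥0∞) + 1)⁻¹ + ∫⁻ y, W y ∂(Q x) ≤ W x}, hmeas, ?_, fun j => ?_⟩
  · refine Set.eq_univ_of_forall fun x => Set.mem_iUnion.2 ?_
    obtain ⟨j, hj⟩ := ENNReal.exists_inv_nat_lt (tsub_pos_iff_lt.2 (hlt x)).ne'
    refine ⟨j, ?_⟩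
    calc ((j : ℝ≥0∞) + 1)⁻¹ + ∫⁻ y, W y ∂(Q x)
        ≤ (W x - ∫⁻ y, W y ∂(Q x)) + ∫⁻ y, W y ∂(Q x) := by
          gcongr
          exact (ENNReal.inv_le_inv.2 le_self_add).trans hj.le
      _ = W x := tsub_add_cancel_of_le (hlt x).le
  · have htop : (j : ℝ≥0∞) + 1 ≠ ⊤ := by finiteness
    refine ⟨((j : ℝ≥0∞) + 1) * M, ENNReal.mul_lt_top htop.lt_top hM, fun x => ?_⟩
    rw [ENNReal.tsum_eq_iSup_nat]
    refine iSup_le fun N => ?_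
    rw [← ENNReal.inv_mul_le_iff (by simp) htop]
    refine (mul_sum_kiter_le_of_drift Q (hmeas j) (fun y => ?_) N x).trans (hWM x)
    by_cases hy : y ∈ {x | ((j : ℝ≥0∞) + 1)⁻¹ + ∫⁻ y, W y ∂(Q x) ≤ W x}
    · rw [Set.indicator_of_mem hy]
      exact hy
    · rw [Set.indicator_of_notMem hy, zero_add]
      exact (hlt y).le

/-- Chebyshev's inequality for a Gaussian measure whose mean dominates `r`. -/
theorem gaussianReal_abs_lt_le {m σ r d : ℝ} (hσ : 0 < σ) (hd : 0 < d)
    (h : r + d * σ ≤ |m|) :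
    gaussianReal m (Real.toNNReal (σ ^ 2)) {y | |y| < r} ≤ ENNReal.ofReal (1 / d ^ 2) := by
  have hcheb := meas_ge_le_variance_div_sq
    (memLp_id_gaussianReal (μ := m) (v := Real.toNNReal (σ ^ 2)) 2) (mul_pos hd hσ)
  simp only [variance_id_gaussianReal, id_eq, integral_id_gaussianReal,
    Real.coe_toNNReal _ (sq_nonneg σ)] at hcheb
  have hvar : σ ^ 2 / (d * σ) ^ 2 = 1 / d ^ 2 := by field_simp
  rw [hvar] at hcheb
  refine (measure_mono fun y (hy : |y| < r) => ?_).trans hcheb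
  have hsub := abs_sub_abs_le_abs_sub m y
  rw [abs_sub_comm] at hsub
  exact (by linarith : d * σ ≤ |y - m|)

/-- A Gaussian kernel whose mean overshoots, in absolute value, by a factor `l > 1` and by at
least `c * |x|` standard deviations is transient. -/
theorem isTransientKernel_of_overshoot {μ S : ℝ → ℝ} (hSpos : ∀ x, 0 < S x) {Q : Kernel ℝ ℝ}
    (hQ : ∀ x, Q x = gaussianReal (μ x) (Real.toNNReal ((S x) ^ 2)))
    {l c R₀ : ℝ} (hl : 1 < l) (hc : 0 < c)
    (h : ∀ x, R₀ ≤ |x| → l * |x| + c * |x| * S x ≤ |μ x|) : IsTransientKernel Q := by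
  obtain ⟨R, hRpos, hR₀, hRc⟩ : ∃ R : ℝ, 0 < R ∧ R₀ ≤ R ∧ 1 / (c ^ 2 * R ^ 2) ≤ 1 - 1 / l := by
    have hgap : 0 < 1 - 1 / l := by
      rw [sub_pos, div_lt_one (by linarith)]
      exact hl
    have hlim : Tendsto (fun R : ℝ => 1 / (c ^ 2 * R ^ 2)) atTop (nhds 0) := by
      simp only [one_div]
      exact ((tendsto_pow_atTop two_ne_zero).const_mul_atTop (by positivity)).inv_tendsto_atTop
    obtain ⟨R, h₁, h₂, h₃⟩ := ((hlim.eventually_le_const hgap).and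
      ((eventually_gt_atTop 0).and (eventually_ge_atTop R₀))).exists
    exact ⟨R, h₂, h₃, h₁⟩
  have hmax (y : ℝ) : 0 < max |y| R := lt_max_of_lt_right hRpos
  have hWle (y : ℝ) : ENNReal.ofReal (1 / max |y| R) ≤ ENNReal.ofReal (1 / R) :=
    ENNReal.ofReal_le_ofReal (one_div_le_one_div_of_le hRpos (le_max_right _ _))
  have hWmeas : Measurable fun y : ℝ => ENNReal.ofReal (1 / max |y| R) := by fun_prop
  refine isTransientKernel_of_lintegral_lt Q hWmeas ENNReal.ofReal_lt_top hWle fun x => ?_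
  have hprob : IsProbabilityMeasure (Q x) := by
    rw [hQ]
    infer_instance
  rcases le_or_gt |x| R with hx | hx
  · have hv : Real.toNNReal ((S x) ^ 2) ≠ 0 := by
      have := hSpos x
      positivity
    rw [max_eq_right hx]
    have hpos : Q x (Set.Ioi R) ≠ 0 := by
      intro h0
      rw [hQ] at h0
      simpa using gaussianReal_absolutelyContinuous' (μ x) hv h0
    have hconst : ∫⁻ _, ENNReal.ofReal (1 / R) ∂(Q x) = ENNReal.ofReal (1 / R) := by simp
    rw [← hconst]
    refine lintegral_strict_mono_of_ae_le_of_ae_lt_on (s := Set.Ioi R) aemeasurable_const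
      ?_ (.of_forall hWle) hpos (.of_forall fun y hy => ?_)
    · exact ((lintegral_mono hWle).trans_lt (by simp)).ne
    · have hy' : R < max |y| R := lt_max_of_lt_left (lt_of_lt_of_le hy (le_abs_self y))
      exact (ENNReal.ofReal_lt_ofReal_iff (by positivity)).2
        (one_div_lt_one_div_of_lt hRpos hy')
  · have hx0 : 0 < |x| := hRpos.trans hx
    have hl0 : 0 < l := one_pos.trans hl
    have hset : MeasurableSet {y : ℝ | |y| < l * |x|} :=
      measurableSet_lt measurable_id.abs measurable_const
    have hbound (y : ℝ) : ENNReal.ofReal (1 / max |y| R) ≤ ENNReal.ofReal (1 / (l * |x|)) +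
        {y : ℝ | |y| < l * |x|}.indicator (fun _ => ENNReal.ofReal (1 / R)) y := by
      by_cases hy : |y| < l * |x|
      · rw [Set.indicator_of_mem (show y ∈ {y : ℝ | |y| < l * |x|} from hy)]
        exact (hWle y).trans le_add_self
      · refine le_trans ?_ le_self_add
        exact ENNReal.ofReal_le_ofReal (one_div_le_one_div_of_le (by positivity)
          (le_max_of_le_left (not_lt.1 hy)))
    have hcheb : Q x {y | |y| < l * |x|} ≤ ENNReal.ofReal (1 / (c * |x|) ^ 2) := by
      rw [hQ]
      exact gaussianReal_abs_lt_le (hSpos x) (by positivity) (h x (hR₀.trans hx.le))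
    calc ∫⁻ y, ENNReal.ofReal (1 / max |y| R) ∂(Q x)
        ≤ ENNReal.ofReal (1 / (l * |x|)) +
            ENNReal.ofReal (1 / R) * Q x {y | |y| < l * |x|} := by
          refine (lintegral_mono hbound).trans_eq ?_
          rw [lintegral_add_left measurable_const, lintegral_indicator_const hset]
          simp
      _ ≤ ENNReal.ofReal (1 / (l * |x|)) +
            ENNReal.ofReal (1 / R) * ENNReal.ofReal (1 / (c * |x|) ^ 2) := by gcongr
      _ = ENNReal.ofReal (1 / (l * |x|) + 1 / R * (1 / (c * |x|) ^ 2)) := by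
          rw [← ENNReal.ofReal_mul (by positivity), ← ENNReal.ofReal_add] <;> positivity
      _ < ENNReal.ofReal (1 / max |x| R) := by
          rw [max_eq_left hx.le, ENNReal.ofReal_lt_ofReal_iff (by positivity)]
          have hR : 1 / (c ^ 2 * (R * |x|)) < 1 / (c ^ 2 * R ^ 2) :=
            one_div_lt_one_div_of_lt (by positivity)
              (mul_lt_mul_of_pos_left (by nlinarith) (by positivity))
          have heq : 1 / (l * |x|) + 1 / R * (1 / (c * |x|) ^ 2) =
              (1 / l + 1 / (c ^ 2 * (R * |x|))) * (1 / |x|) := by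
            field_simp
          rw [heq]
          exact mul_lt_of_lt_one_left (by positivity) (by linarith)

/-- If `f x * |x| ^ (-χ)` tends to `u > 0` along a filter escaping to infinity, then `f x`
eventually dominates `u' * |x|`, for every `u'` if `1 < χ` and for `u' < u` if `χ = 1`. -/
theorem eventually_mul_abs_le_of_tendsto {F : Filter ℝ} (hF : Tendsto (fun x : ℝ => |x|) F atTop)
    {f : ℝ → ℝ} {χ u u' : ℝ} (hu : 0 < u) (hχ : 1 < χ ∨ χ = 1 ∧ u' < u)
    (hf : Tendsto (fun x => f x * |x| ^ (-χ)) F (nhds u)) :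
    ∀ᶠ x in F, u' * |x| ≤ f x := by
  have key : ∀ᶠ x in F, u' ≤ (f x * |x| ^ (-χ)) * |x| ^ (χ - 1) := by
    rcases hχ with hχ | ⟨rfl, hlt⟩
    · exact (hf.pos_mul_atTop hu
        ((tendsto_rpow_atTop (sub_pos.2 hχ)).comp hF)).eventually_ge_atTop u'
    · simpa using hf.eventually_const_le hlt
  filter_upwards [key, hF.eventually_gt_atTop 0] with x hx h0
  have hpow : |x| ^ (-χ) * |x| ^ (χ - 1) * |x| = 1 := by
    rw [← Real.rpow_add h0, ← Real.rpow_add_one h0.ne',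
      show -χ + (χ - 1) + 1 = 0 by ring, Real.rpow_zero]
  calc u' * |x| ≤ (f x * |x| ^ (-χ)) * |x| ^ (χ - 1) * |x| := by gcongr
    _ = f x * (|x| ^ (-χ) * |x| ^ (χ - 1) * |x|) := by ring
    _ = f x := by rw [hpow, mul_one]

/-- A Gaussian kernel whose standardized mean has absolute value eventually at least `u * |x|` and
whose standard deviation is eventually at least `t`, with `1 < u * t`, is transient. -/
theorem isTransientKernel_of_eventually_le {μ S : ℝ → ℝ} (hSpos : ∀ x, 0 < S x) {Q : Kernel ℝ ℝ}
    (hQ : ∀ x, Q x = gaussianReal (μ x) (Real.toNNReal ((S x) ^ 2)))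
    {u t : ℝ} (ht : 0 < t) (hut : 1 < u * t)
    (hS : ∀ᶠ x in comap (fun x : ℝ => |x|) atTop, t ≤ S x)
    (hμ : ∀ᶠ x in comap (fun x : ℝ => |x|) atTop, u * |x| ≤ (S x)⁻¹ * |μ x|) :
    IsTransientKernel Q := by
  obtain ⟨R₀, hR₀⟩ := eventually_atTop.1 (eventually_comap.1 (hS.and hμ))
  have hc : 0 < u - (1 + u * t) / 2 / t := by
    rw [sub_pos, div_lt_iff₀ ht]
    linarith
  refine isTransientKernel_of_overshoot hSpos hQ (l := (1 + u * t) / 2) (R₀ := R₀)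
    (by linarith) hc fun x hx => ?_
  obtain ⟨hSx, hμx⟩ := hR₀ |x| hx x rfl
  rw [le_inv_mul_iff₀ (hSpos x)] at hμx
  have hle : (1 + u * t) / 2 ≤ (1 + u * t) / 2 / t * S x := by
    rw [div_mul_eq_mul_div, le_div_iff₀ ht]
    exact mul_le_mul_of_nonneg_left hSx (by linarith)
  linarith [mul_le_mul_of_nonneg_right hle (abs_nonneg x)]

theorem gaussian_markov_kernel_transient (μ S : ℝ → ℝ)
    (hμcont : Continuous μ) (hScont : Continuous S) (hSpos : ∀ x, 0 < S x)
    (s : ℝ) (hs : 0 < s)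
    -- `liminf_{|x|→∞} S(x) ≥ s`
    (hS : ∀ ε : ℝ, 0 < ε → ∀ᶠ x in Filter.comap (fun x : ℝ => |x|) atTop, s - ε ≤ S x)
    (χ uplus uminus : ℝ) (huplus : 0 < uplus) (huminus : 0 < uminus)
    (hlimplus : Tendsto (fun x : ℝ => (S x)⁻¹ * μ x * x ^ (-χ)) atTop (nhds (-uplus)))
    (hlimminus : Tendsto (fun x : ℝ => (S x)⁻¹ * μ x * |x| ^ (-χ)) atBot (nhds uminus))
    (Q : Kernel ℝ ℝ)
    (hQ : ∀ x, Q x = gaussianReal (μ x) (Real.toNNReal ((S x) ^ 2))) :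
    (1 < χ → IsTransientKernel Q) ∧
    (χ = 1 ∧ 1 < min uplus uminus * s → IsTransientKernel Q) := by
  have hplus : Tendsto (fun x : ℝ => (S x)⁻¹ * |μ x| * |x| ^ (-χ)) atTop (nhds uplus) := by
    have habs := hlimplus.abs
    rw [abs_neg, abs_of_pos huplus] at habs
    refine habs.congr' ?_
    filter_upwards [eventually_gt_atTop 0] with x hx
    rw [abs_mul, abs_mul, abs_of_pos (inv_pos.2 (hSpos x)), abs_of_pos hx,
      abs_of_nonneg (Real.rpow_nonneg hx.le _)]
  have hminus : Tendsto (fun x : ℝ => (S x)⁻¹ * |μ x| * |x| ^ (-χ)) atBot (nhds uminus) := by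
    have habs := hlimminus.abs
    rw [abs_of_pos huminus] at habs
    refine habs.congr fun x => ?_
    rw [abs_mul, abs_mul, abs_of_pos (inv_pos.2 (hSpos x)),
      abs_of_nonneg (Real.rpow_nonneg (abs_nonneg x) _)]
  have hmean (u : ℝ) (hu : 1 < χ ∨ χ = 1 ∧ u < min uplus uminus) :
      ∀ᶠ x in comap (fun x : ℝ => |x|) atTop, u * |x| ≤ (S x)⁻¹ * |μ x| := by
    rw [comap_abs_atTop, eventually_sup]
    exact ⟨eventually_mul_abs_le_of_tendsto tendsto_abs_atBot_atTop huminus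
        (hu.imp_right fun h => ⟨h.1, h.2.trans_le (min_le_right _ _)⟩) hminus,
      eventually_mul_abs_le_of_tendsto tendsto_abs_atTop_atTop huplus
        (hu.imp_right fun h => ⟨h.1, h.2.trans_le (min_le_left _ _)⟩) hplus⟩
  have htrans (u t : ℝ) (ht : 0 < t) (hts : t < s) (hut : 1 < u * t)
      (hu : 1 < χ ∨ χ = 1 ∧ u < min uplus uminus) : IsTransientKernel Q := by
    refine isTransientKernel_of_eventually_le hSpos hQ ht hut ?_ (hmean u hu)
    simpa using hS (s - t) (sub_pos.2 hts)
  refine ⟨fun hχ => ?_, fun ⟨hχ, hmin⟩ => ?_⟩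
  · refine htrans (4 / s) (s / 2) (half_pos hs) (half_lt_self hs) ?_ (.inl hχ)
    field_simp
    norm_num
  · have hmpos : 0 < min uplus uminus := lt_min huplus huminus
    obtain ⟨t, hlt, hts⟩ := exists_between ((div_lt_iff₀' hmpos).2 hmin)
    have ht : 0 < t := (one_div_pos.2 hmpos).trans hlt
    rw [div_lt_iff₀' hmpos, ← div_lt_iff₀ ht] at hlt
    obtain ⟨u, hlu, hu⟩ := exists_between hlt
    exact htrans u t ht hts ((div_lt_iff₀ ht).1 hlu) (.inr ⟨hχ, hu⟩)
end

section
/- For every real t ≠ 0, (e^{t} − 1)/t + (1/3)(e^{-t²} − 1)/t > 0; equivalently, the function t ↦ (e^{t} − 1)/t + (1/3)(e^{-t²} − 1)/t, extended by the value 1 at t = 0, is positive on all of ℝ. -/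
theorem boma_variance_eigenvalue_pos (t : ℝ) :
    0 < if t = 0 then (1 : ℝ)
      else (Real.exp t - 1) / t + (1 / 3) * (Real.exp (-t ^ 2) - 1) / t := by
  split_ifs with h
  · exact one_pos
  rw [← add_div]
  rcases lt_or_gt_of_ne h with ht | ht
  · have h₁ : Real.exp t < 1 := Real.exp_lt_one_iff.mpr ht
    have h₂ : Real.exp (-t ^ 2) ≤ 1 := Real.exp_le_one_iff.mpr (by nlinarith [sq_nonneg t])
    exact div_pos_of_neg_of_neg (by linarith) ht
  · have h₁ : 1 + t + t ^ 2 / 2 ≤ Real.exp t := Real.quadratic_le_exp_of_nonneg ht.le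
    have h₂ : -t ^ 2 + 1 ≤ Real.exp (-t ^ 2) := Real.add_one_le_exp _
    exact div_pos (by linarith [sq_nonneg t]) ht
end
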